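/- arXiv:2307.03527 — 3 statements merged into one kernel-verified Lean document; each statement's English description precedes it below -/
import Mathlib

section
/- Let n ≥ 2 be an integer. For every smooth compactly supported function f : ℝ^n → ℝ with ∫_{ℝ^n} |f| dx = 1 one has ∫_{ℝ^n} |f| log |f| dx ≤ n log ( n^{-1} ω_n^{-1/n} ∫_{ℝ^n} |∇f| dx ), where the integrand |f| log |f| is interpreted as 0 at points where f vanishes. -/
open Real MeasureTheory Filter Topology

/-- The volume of the unit ball in `ℝ^n`: `ω_n = π^(n/2) / Γ(n/2 + 1)`. -/
noncomputable def ballVol (n : ℕ) : ℝ := Real.pi ^ ((n : ℝ) / 2) / Real.Gamma ((n : ℝ) / 2 + 1)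

/-- The Prékopa–Leindler inequality for the measure `μ`. -/
def PrekopaLeindler {E : Type*} [AddCommGroup E] [Module ℝ E] [MeasurableSpace E]
    (μ : Measure E) : Prop :=
  ∀ ⦃a b : ℝ⦄, 0 < a → 0 < b → a + b = 1 → ∀ ⦃f g h : E → ENNReal⦄,
    Measurable f → Measurable g → Measurable h →
    (∀ x y, f x ^ a * g y ^ b ≤ h (a • x + b • y)) →
    (∫⁻ x, f x ∂μ) ^ a * (∫⁻ x, g x ∂μ) ^ b ≤ ∫⁻ x, h x ∂μ

theorem PrekopaLeindler.prod {E F : Type*} [AddCommGroup E] [Module ℝ E] [MeasurableSpace E]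
    [AddCommGroup F] [Module ℝ F] [MeasurableSpace F] {μ : Measure E} {ν : Measure F}
    [SFinite μ] [SFinite ν] (hμ : PrekopaLeindler μ) (hν : PrekopaLeindler ν) :
    PrekopaLeindler (μ.prod ν) := by
  intro a b ha hb hab f g h hf hg hh H
  rw [lintegral_prod _ hf.aemeasurable, lintegral_prod _ hg.aemeasurable,
    lintegral_prod _ hh.aemeasurable]
  refine hμ ha hb hab hf.lintegral_prod_right' hg.lintegral_prod_right'
    hh.lintegral_prod_right' fun x y => ?_
  exact hν ha hb hab (hf.comp measurable_prodMk_left) (hg.comp measurable_prodMk_left)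
    (hh.comp measurable_prodMk_left) fun u v => H (x, u) (y, v)

theorem PrekopaLeindler.of_measurableEquiv {E F : Type*} [AddCommGroup E] [Module ℝ E]
    [MeasurableSpace E] [AddCommGroup F] [Module ℝ F] [MeasurableSpace F] {μ : Measure E}
    {ν : Measure F} (hν : PrekopaLeindler ν) (e : E ≃ᵐ F) (he : MeasurePreserving e μ ν)
    (hlin : ∀ (a b : ℝ) (x y : E), e (a • x + b • y) = a • e x + b • e y) :
    PrekopaLeindler μ := by
  intro a b ha hb hab f g h hf hg hh H
  have key : ∀ k : E → ENNReal, ∫⁻ x, k x ∂μ = ∫⁻ y, k (e.symm y) ∂ν := fun k => by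
    rw [← he.lintegral_comp_emb e.measurableEmbedding]
    simp
  rw [key f, key g, key h]
  refine hν ha hb hab (hf.comp e.symm.measurable) (hg.comp e.symm.measurable)
    (hh.comp e.symm.measurable) fun x y => ?_
  have : e.symm (a • x + b • y) = a • e.symm x + b • e.symm y := by
    rw [e.symm_apply_eq, hlin]
    simp
  simpa [this] using H (e.symm x) (e.symm y)

/-- The Brunn–Minkowski inequality on the real line. -/
theorem Real.volume_add_volume_le_of_add_mem {A B C : Set ℝ} (hA : MeasurableSet A)
    (hB : MeasurableSet B) (hA' : A.Nonempty) (hB' : B.Nonempty)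
    (H : ∀ x ∈ A, ∀ y ∈ B, x + y ∈ C) : volume A + volume B ≤ volume C := by
  have compact_case : ∀ K ⊆ A, IsCompact K → K.Nonempty → ∀ L ⊆ B, IsCompact L → L.Nonempty →
      volume K + volume L ≤ volume C := by
    intro K hKA hK hK0 L hLB hL hL0
    obtain ⟨k, hk⟩ := hK.exists_isGreatest hK0
    obtain ⟨l, hl⟩ := hL.exists_isLeast hL0
    have hnull : AEDisjoint volume ((fun x => x + l) '' K) ((fun y => k + y) '' L) := by
      refine measure_mono_null (t := {k + l}) ?_ (measure_singleton _)
      rintro _ ⟨⟨x, hx, rfl⟩, ⟨y, hy, hxy⟩⟩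
      have := hk.2 hx
      have := hl.2 hy
      simp only [Set.mem_singleton_iff] at hxy ⊢
      linarith
    calc volume K + volume L
        = volume ((fun x => x + l) '' K) + volume ((fun y => k + y) '' L) := by
          simp [Set.image_add_right, Set.image_add_left]
      _ = volume (((fun x => x + l) '' K) ∪ ((fun y => k + y) '' L)) := by
          refine (measure_union₀ ?_ hnull).symm
          exact (hL.image (by fun_prop)).measurableSet.nullMeasurableSet
      _ ≤ volume C := by
          refine measure_mono ?_
          rintro _ (⟨x, hx, rfl⟩ | ⟨y, hy, rfl⟩)
          · exact H _ (hKA hx) _ (hLB hl.1)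
          · exact H _ (hKA hk.1) _ (hLB hy)
  have left_case : ∀ L ⊆ B, IsCompact L → L.Nonempty → volume A + volume L ≤ volume C := by
    intro L hLB hL hL0
    rw [hA.measure_eq_iSup_isCompact]
    simp only [ENNReal.iSup_add]
    refine iSup_le fun K => ?_
    by_cases hKA : K ⊆ A
    swap
    · obtain ⟨x, hx⟩ := hA'
      have := compact_case {x} (by simpa using hx) isCompact_singleton (by simp) L hLB hL hL0
      simpa [hKA] using this
    by_cases hK : IsCompact K
    swap
    · obtain ⟨x, hx⟩ := hA'
      have := compact_case {x} (by simpa using hx) isCompact_singleton (by simp) L hLB hL hL0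
      simpa [hK] using this
    rcases K.eq_empty_or_nonempty with rfl | hK0
    · obtain ⟨x, hx⟩ := hA'
      have := compact_case {x} (by simpa using hx) isCompact_singleton (by simp) L hLB hL hL0
      simpa using this
    · simpa [hKA, hK] using compact_case K hKA hK hK0 L hLB hL hL0
  rw [hB.measure_eq_iSup_isCompact]
  simp only [ENNReal.add_iSup]
  have base : volume A ≤ volume C := by
    obtain ⟨y, hy⟩ := hB'
    simpa using left_case {y} (by simpa using hy) isCompact_singleton (by simp)
  refine iSup_le fun L => ?_
  by_cases hLB : L ⊆ B
  swap
  · simpa [hLB] using base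
  by_cases hL : IsCompact L
  swap
  · simpa [hL] using base
  rcases L.eq_empty_or_nonempty with rfl | hL0
  · simpa using base
  · simpa [hLB, hL] using left_case L hLB hL hL0

theorem MeasureTheory.lintegral_eq_lintegral_Ioo_meas_lt {α : Type*} [MeasurableSpace α]
    (μ : Measure α) {f : α → ENNReal} (hf : Measurable f) (hf1 : ∀ x, f x ≤ 1) :
    ∫⁻ x, f x ∂μ = ∫⁻ t in Set.Ioo (0 : ℝ) 1, μ {x | ENNReal.ofReal t < f x} := by
  have hfin : ∀ x, f x ≠ ⊤ := fun x => ne_top_of_le_ne_top ENNReal.one_ne_top (hf1 x)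
  have h1 := lintegral_eq_lintegral_meas_lt μ (f := fun x => (f x).toReal)
    (ae_of_all _ fun x => ENNReal.toReal_nonneg) hf.ennreal_toReal.aemeasurable
  simp only [ENNReal.ofReal_toReal (hfin _)] at h1
  have h2 : ∀ t : ℝ, 0 ≤ t → {a | t < (f a).toReal} = {x | ENNReal.ofReal t < f x} :=
    fun t ht => by
      ext x
      exact (ENNReal.ofReal_lt_iff_lt_toReal ht (hfin x)).symm
  rw [h1, ← Set.Ioo_union_Ici_eq_Ioi (zero_lt_one' ℝ),
    lintegral_union measurableSet_Ici (by
      rw [Set.disjoint_left]; intro x hx hx'; exact absurd hx.2 (not_lt.2 hx'))]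
  have h3 : ∫⁻ t in Set.Ici (1 : ℝ), μ {a | t < (f a).toReal} = 0 := by
    rw [setLIntegral_congr_fun (g := fun _ => 0) measurableSet_Ici, lintegral_zero]
    intro t ht
    have : {a | t < (f a).toReal} = ∅ := by
      ext x
      simp only [Set.mem_ofPred_eq, Set.mem_empty_iff_false, iff_false, not_lt]
      refine le_trans ?_ (Set.mem_Ici.1 ht)
      simpa using ENNReal.toReal_mono ENNReal.one_ne_top (hf1 x)
    simp [this]
  rw [h3, add_zero]
  exact setLIntegral_congr_fun measurableSet_Ioo fun t ht => by simp only [h2 t ht.1.le]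

theorem ENNReal.geom_mean_le_arith_mean2_weighted {a b : ℝ} (ha : 0 < a) (hb : 0 < b)
    (hab : a + b = 1) (x y : ENNReal) :
    x ^ a * y ^ b ≤ ENNReal.ofReal a * x + ENNReal.ofReal b * y := by
  by_cases hx : x = ⊤
  · simp [hx, ENNReal.mul_top, ha]
  by_cases hy : y = ⊤
  · simp [hy, ENNReal.mul_top, hb]
  lift x to NNReal using hx
  lift y to NNReal using hy
  have := NNReal.geom_mean_le_arith_mean2_weighted ⟨a, ha.le⟩ ⟨b, hb.le⟩ x y
    (NNReal.coe_inj.1 hab)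
  rw [← ENNReal.coe_rpow_of_nonneg _ ha.le, ← ENNReal.coe_rpow_of_nonneg _ hb.le,
    ENNReal.ofReal_eq_coe_nnreal ha.le, ENNReal.ofReal_eq_coe_nnreal hb.le]
  exact_mod_cast this

open scoped Pointwise in
theorem Real.prekopaLeindler_of_normalized {a b : ℝ} (ha : 0 < a) (hb : 0 < b) (hab : a + b = 1)
    {f g h : ℝ → ENNReal} (hf : Measurable f) (hg : Measurable g) (hh : Measurable h)
    (hf1 : ⨆ x, f x = 1) (hg1 : ⨆ x, g x = 1)
    (H : ∀ x y, f x ^ a * g y ^ b ≤ h (a • x + b • y)) :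
    (∫⁻ x, f x) ^ a * (∫⁻ x, g x) ^ b ≤ ∫⁻ x, h x := by
  have hf1' : ∀ x, f x ≤ 1 := fun x => hf1 ▸ le_iSup f x
  have hg1' : ∀ x, g x ≤ 1 := fun x => hg1 ▸ le_iSup g x
  refine (ENNReal.geom_mean_le_arith_mean2_weighted ha hb hab _ _).trans ?_
  calc (ENNReal.ofReal a * ∫⁻ x, f x) + ENNReal.ofReal b * ∫⁻ x, g x
      = (∫⁻ t in Set.Ioo (0 : ℝ) 1, ENNReal.ofReal a * volume {x | ENNReal.ofReal t < f x}) +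
        ∫⁻ t in Set.Ioo (0 : ℝ) 1, ENNReal.ofReal b * volume {x | ENNReal.ofReal t < g x} := by
        rw [lintegral_eq_lintegral_Ioo_meas_lt _ hf hf1',
          lintegral_eq_lintegral_Ioo_meas_lt _ hg hg1',
          lintegral_const_mul' _ _ ENNReal.ofReal_ne_top,
          lintegral_const_mul' _ _ ENNReal.ofReal_ne_top]
    _ ≤ ∫⁻ t in Set.Ioo (0 : ℝ) 1, (ENNReal.ofReal a * volume {x | ENNReal.ofReal t < f x} +
        ENNReal.ofReal b * volume {x | ENNReal.ofReal t < g x}) := le_lintegral_add _ _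
    _ ≤ ∫⁻ t in Set.Ioo (0 : ℝ) 1, volume {x | ENNReal.ofReal t < min (h x) 1} := by
        refine setLIntegral_mono' measurableSet_Ioo fun t ht => ?_
        have ht1 : ENNReal.ofReal t < 1 := by simpa using ht.2
        have e : ∀ (c : ℝ) (_ : 0 < c) (S : Set ℝ), ENNReal.ofReal c * volume S =
            volume (c • S) := fun c hc S => by
          rw [Measure.addHaar_smul]; simp [abs_of_pos hc]
        rw [e a ha, e b hb]
        refine Real.volume_add_volume_le_of_add_mem
          ((measurableSet_lt measurable_const hf).const_smul₀ a)
          ((measurableSet_lt measurable_const hg).const_smul₀ b) ?_ ?_ ?_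
        · rw [← hf1] at ht1
          exact Set.Nonempty.smul_set (lt_iSup_iff.1 ht1)
        · rw [← hg1] at ht1
          exact Set.Nonempty.smul_set (lt_iSup_iff.1 ht1)
        · rintro _ ⟨x, hx, rfl⟩ _ ⟨y, hy, rfl⟩
          refine lt_min ?_ ht1
          refine lt_of_lt_of_le ?_ (H x y)
          calc ENNReal.ofReal t = ENNReal.ofReal t ^ a * ENNReal.ofReal t ^ b := by
                rw [← ENNReal.rpow_add_of_nonneg _ _ ha.le hb.le, hab, ENNReal.rpow_one]
            _ < _ := ENNReal.mul_lt_mul (ENNReal.rpow_lt_rpow hx ha)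
                (ENNReal.rpow_lt_rpow hy hb)
    _ = ∫⁻ x, min (h x) 1 :=
        (lintegral_eq_lintegral_Ioo_meas_lt _ (hh.min measurable_const)
          fun x => min_le_right _ _).symm
    _ ≤ ∫⁻ x, h x := lintegral_mono fun x => min_le_left _ _

theorem Real.prekopaLeindler_of_bounded {a b : ℝ} (ha : 0 < a) (hb : 0 < b) (hab : a + b = 1)
    {f g h : ℝ → ENNReal} (hf : Measurable f) (hg : Measurable g) (hh : Measurable h)
    (hfb : ⨆ x, f x ≠ ⊤) (hgb : ⨆ x, g x ≠ ⊤)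
    (H : ∀ x y, f x ^ a * g y ^ b ≤ h (a • x + b • y)) :
    (∫⁻ x, f x) ^ a * (∫⁻ x, g x) ^ b ≤ ∫⁻ x, h x := by
  by_cases hf0 : ⨆ x, f x = 0
  · simp [show f = fun _ => 0 from funext (by simpa using hf0), ha]
  by_cases hg0 : ⨆ x, g x = 0
  · simp [show g = fun _ => 0 from funext (by simpa using hg0), hb]
  set α := ⨆ x, f x
  set β := ⨆ x, g x
  have hα0 : α ^ a ≠ 0 := by simp [hf0, hfb]
  have hβ0 : β ^ b ≠ 0 := by simp [hg0, hgb]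
  have hα : α ^ a ≠ ⊤ := by simp [hfb, hf0]
  have hβ : β ^ b ≠ ⊤ := by simp [hgb, hg0]
  have key := Real.prekopaLeindler_of_normalized ha hb hab (hf.const_mul α⁻¹)
    (hg.const_mul β⁻¹) (hh.const_mul (α ^ a * β ^ b)⁻¹)
    (by rw [← ENNReal.mul_iSup, ENNReal.inv_mul_cancel hf0 hfb])
    (by rw [← ENNReal.mul_iSup, ENNReal.inv_mul_cancel hg0 hgb])
    (fun x y => by
      rw [ENNReal.mul_rpow_of_nonneg _ _ ha.le, ENNReal.mul_rpow_of_nonneg _ _ hb.le,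
        ENNReal.inv_rpow, ENNReal.inv_rpow, mul_mul_mul_comm,
        ← ENNReal.mul_inv (.inl hα0) (.inl hα)]
      gcongr
      exact H x y)
  rw [lintegral_const_mul _ hf, lintegral_const_mul _ hg, lintegral_const_mul _ hh,
    ENNReal.mul_rpow_of_nonneg _ _ ha.le, ENNReal.mul_rpow_of_nonneg _ _ hb.le,
    ENNReal.inv_rpow, ENNReal.inv_rpow, mul_mul_mul_comm,
    ← ENNReal.mul_inv (.inl hα0) (.inl hα)] at key
  refine (ENNReal.mul_le_mul_iff_right ?_ ?_).1 key
  · exact ENNReal.inv_ne_zero.2 (ENNReal.mul_ne_top hα hβ)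
  · exact ENNReal.inv_ne_top.2 (mul_ne_zero hα0 hβ0)

theorem Real.prekopaLeindler_volume : PrekopaLeindler (volume : Measure ℝ) := by
  intro a b ha hb hab f g h hf hg hh H
  have trunc : ∀ N : ℕ, (∫⁻ x, min (f x) N) ^ a * (∫⁻ x, min (g x) N) ^ b ≤ ∫⁻ x, h x :=
    fun N => Real.prekopaLeindler_of_bounded ha hb hab (hf.min measurable_const)
      (hg.min measurable_const) hh
      (ne_top_of_le_ne_top (ENNReal.natCast_ne_top N) (iSup_le fun x => min_le_right _ _))
      (ne_top_of_le_ne_top (ENNReal.natCast_ne_top N) (iSup_le fun x => min_le_right _ _))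
      (fun x y => le_trans (by gcongr <;> exact min_le_left _ _) (H x y))
  have lim : ∀ k : ℝ → ENNReal, Measurable k →
      Tendsto (fun N : ℕ => ∫⁻ x, min (k x) N) atTop (𝓝 (∫⁻ x, k x)) := by
    intro k hk
    refine lintegral_tendsto_of_tendsto_of_monotone
      (fun N => (hk.min measurable_const).aemeasurable) (ae_of_all _ fun x N M hNM => ?_)
      (ae_of_all _ fun x => ?_)
    · exact min_le_min le_rfl (by exact_mod_cast hNM)
    · simpa using tendsto_const_nhds.min ENNReal.tendsto_nat_nhds_top
  by_cases hf0 : ∫⁻ x, f x = 0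
  · simp [hf0, ha]
  by_cases hg0 : ∫⁻ x, g x = 0
  · simp [hg0, hb]
  refine le_of_tendsto (ENNReal.Tendsto.mul ((lim f hf).ennrpow_const a) (.inl ?_)
    ((lim g hg).ennrpow_const b) (.inl ?_)) (Eventually.of_forall trunc)
  · simp [hf0, ha, ha.le]
  · simp [hg0, hb, hb.le]

theorem prekopaLeindler_volume_pi : ∀ n : ℕ, PrekopaLeindler (volume : Measure (Fin n → ℝ))
  | 0 => by
    intro a b ha hb hab f g h hf hg hh H
    have hvol : (volume : Measure (Fin 0 → ℝ)) = Measure.dirac 0 := by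
      rw [volume_pi, Measure.pi_of_empty]
      congr
      exact Subsingleton.elim _ _
    rw [hvol, lintegral_dirac' _ hf, lintegral_dirac' _ hg, lintegral_dirac' _ hh]
    simpa using H 0 0
  | n + 1 => (Real.prekopaLeindler_volume.prod (prekopaLeindler_volume_pi n)).of_measurableEquiv
      (MeasurableEquiv.piFinSuccAbove (fun _ => ℝ) 0)
      (volume_preserving_piFinSuccAbove (fun _ => ℝ) 0) fun a b x y => rfl

theorem EuclideanSpace.prekopaLeindler_volume (n : ℕ) :
    PrekopaLeindler (volume : Measure (EuclideanSpace ℝ (Fin n))) :=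
  (prekopaLeindler_volume_pi n).of_measurableEquiv (MeasurableEquiv.toLp 2 (Fin n → ℝ)).symm
    (EuclideanSpace.volume_preserving_symm_measurableEquiv_toLp (Fin n)) fun _ _ _ _ => rfl

theorem ballVol_pos (n : ℕ) : 0 < ballVol n :=
  div_pos (Real.rpow_pos_of_pos Real.pi_pos _) (Real.Gamma_pos_of_pos (by positivity))

theorem EuclideanSpace.volume_ball_eq_ballVol {n : ℕ} (hn : n ≠ 0) (x : EuclideanSpace ℝ (Fin n))
    {r : ℝ} (hr : 0 ≤ r) : volume (Metric.ball x r) = ENNReal.ofReal (r ^ n * ballVol n) := by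
  have : Nonempty (Fin n) := ⟨⟨0, Nat.pos_of_ne_zero hn⟩⟩
  rw [EuclideanSpace.volume_ball, Fintype.card_fin, ← ENNReal.ofReal_pow hr,
    ← ENNReal.ofReal_mul (by positivity), ballVol, Real.sqrt_eq_rpow, ← Real.rpow_natCast (_ ^ _),
    ← Real.rpow_mul Real.pi_pos.le]
  congr 4
  ring_nf

open scoped Pointwise in
/-- The Brunn–Minkowski inequality for the sum of a set and a ball. -/
theorem EuclideanSpace.brunnMinkowski_ball {n : ℕ} (hn : n ≠ 0)
    {A C : Set (EuclideanSpace ℝ (Fin n))} (hA : MeasurableSet A) (hC : MeasurableSet C)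
    (hA0 : volume A ≠ 0) (hAfin : volume A ≠ ⊤) {h : ℝ} (hh : 0 < h)
    (H : ∀ x ∈ A, ∀ y ∈ Metric.ball (0 : EuclideanSpace ℝ (Fin n)) h, x + y ∈ C) :
    ENNReal.ofReal (((volume A).toReal ^ (n : ℝ)⁻¹ + h * ballVol n ^ (n : ℝ)⁻¹) ^ n) ≤
      volume C := by
  have hω := ballVol_pos n
  set V := (volume A).toReal with hV
  have hVpos : 0 < V := ENNReal.toReal_pos hA0 hAfin
  set α := V ^ (n : ℝ)⁻¹ with hα
  set w := ballVol n ^ (n : ℝ)⁻¹ with hw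
  have hαpos : 0 < α := Real.rpow_pos_of_pos hVpos _
  have hwpos : 0 < w := Real.rpow_pos_of_pos hω _
  have hαn : α ^ n = V := Real.rpow_inv_natCast_pow hVpos.le hn
  have hwn : w ^ n = ballVol n := Real.rpow_inv_natCast_pow hω.le hn
  set s := α + h * w with hs
  have hspos : 0 < s := by positivity
  have ha : 0 < α / s := by positivity
  have hb : 0 < h * w / s := by positivity
  have hab : α / s + h * w / s = 1 := by field_simp; exact hs.symm
  have key := EuclideanSpace.prekopaLeindler_volume n ha hb hab
    (f := ((s / α) • A).indicator 1)
    (g := (Metric.ball (0 : EuclideanSpace ℝ (Fin n)) (s / w)).indicator 1)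
    (h := C.indicator 1)
    (measurable_one.indicator (hA.const_smul₀ _))
    (measurable_one.indicator measurableSet_ball) (measurable_one.indicator hC) (by
      intro x y
      by_cases hx : x ∈ (s / α) • A
      swap
      · simp [hx, ha]
      by_cases hy : y ∈ Metric.ball (0 : EuclideanSpace ℝ (Fin n)) (s / w)
      swap
      · simp only [Set.indicator_of_notMem hy, ENNReal.zero_rpow_of_pos hb, mul_zero, zero_le]
      obtain ⟨x, hxA, rfl⟩ := hx
      have : (α / s) • (s / α) • x + (h * w / s) • y ∈ C := by
        rw [smul_smul, show α / s * (s / α) = 1 by field_simp, one_smul]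
        refine H x hxA _ ?_
        rw [mem_ball_zero_iff] at hy ⊢
        rw [norm_smul, Real.norm_of_nonneg hb.le]
        calc h * w / s * ‖y‖ < h * w / s * (s / w) := by gcongr
          _ = h := by field_simp
      rw [Set.indicator_of_mem this]
      simp only [Pi.one_apply]
      exact mul_le_one' (ENNReal.rpow_le_one (Set.indicator_le_self' (by simp) _) ha.le)
        (ENNReal.rpow_le_one (Set.indicator_le_self' (by simp) _) hb.le))
  rw [lintegral_indicator_one (hA.const_smul₀ _), lintegral_indicator_one measurableSet_ball,
    lintegral_indicator_one hC, Measure.addHaar_smul, finrank_euclideanSpace_fin,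
    EuclideanSpace.volume_ball_eq_ballVol hn _ (by positivity), abs_of_pos (by positivity),
    ← ENNReal.ofReal_toReal hAfin, ← hV, ← ENNReal.ofReal_mul (by positivity),
    ← hαn, ← hwn, ← mul_pow, ← mul_pow, div_mul_cancel₀ _ hαpos.ne',
    div_mul_cancel₀ _ hwpos.ne', ← ENNReal.rpow_add_of_nonneg _ _ ha.le hb.le, hab,
    ENNReal.rpow_one] at key
  exact key

theorem EuclideanSpace.volume_add_perimeter_le {n : ℕ} (hn : 2 ≤ n)
    {A C : Set (EuclideanSpace ℝ (Fin n))} (hA : MeasurableSet A) (hC : MeasurableSet C)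
    (hAfin : volume A ≠ ⊤) {h : ℝ} (hh : 0 < h)
    (H : ∀ x ∈ A, ∀ y ∈ Metric.ball (0 : EuclideanSpace ℝ (Fin n)) h, x + y ∈ C) :
    volume A + ENNReal.ofReal h * (ENNReal.ofReal (n * ballVol n ^ (n : ℝ)⁻¹) *
      volume A ^ (1 - (n : ℝ)⁻¹)) ≤ volume C := by
  have hn0 : n ≠ 0 := by omega
  have hexp : 0 < 1 - (n : ℝ)⁻¹ := by
    have : (2 : ℝ) ≤ n := by exact_mod_cast hn
    have : (n : ℝ)⁻¹ ≤ 2⁻¹ := by gcongr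
    linarith
  by_cases hA0 : volume A = 0
  · simp [hA0, hexp]
  refine le_trans ?_ (EuclideanSpace.brunnMinkowski_ball hn0 hA hC hA0 hAfin hh H)
  have hω := ballVol_pos n
  have hVpos : 0 < (volume A).toReal := ENNReal.toReal_pos hA0 hAfin
  set V := (volume A).toReal with hV
  rw [← ENNReal.ofReal_toReal hAfin, ← hV, ENNReal.ofReal_rpow_of_pos hVpos,
    ← ENNReal.ofReal_mul (by positivity), ← ENNReal.ofReal_mul hh.le,
    ← ENNReal.ofReal_add hVpos.le (by positivity)]
  refine ENNReal.ofReal_le_ofReal ?_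
  set α := V ^ (n : ℝ)⁻¹ with hα
  set w := ballVol n ^ (n : ℝ)⁻¹ with hw
  have hαpos : 0 < α := Real.rpow_pos_of_pos hVpos _
  have hwpos : 0 < w := Real.rpow_pos_of_pos hω _
  have hαn : α ^ n = V := Real.rpow_inv_natCast_pow hVpos.le hn0
  have hpow : V ^ (1 - (n : ℝ)⁻¹) = V / α := by rw [Real.rpow_sub hVpos, Real.rpow_one]
  have bern := one_add_mul_le_pow (a := h * w / α) (by
    have : 0 < h * w / α := by positivity
    linarith) n
  calc V + h * (n * w * V ^ (1 - (n : ℝ)⁻¹)) = V * (1 + n * (h * w / α)) := by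
        rw [hpow]; field_simp
    _ ≤ V * (1 + h * w / α) ^ n := by gcongr
    _ = (α + h * w) ^ n := by
        rw [← hαn, ← mul_pow]; congr 1; field_simp

theorem lintegral_superlevel_rpow_le_lintegral_norm_fderiv {n : ℕ} (hn : 2 ≤ n)
    {f : EuclideanSpace ℝ (Fin n) → ℝ} (hf : ContDiff ℝ 1 f) (hsupp : HasCompactSupport f) :
    ENNReal.ofReal (n * ballVol n ^ (n : ℝ)⁻¹) *
      ∫⁻ t in Set.Ioi (0 : ℝ), volume {x | t < |f x|} ^ (1 - (n : ℝ)⁻¹) ≤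
      ∫⁻ x, ENNReal.ofReal ‖fderiv ℝ f x‖ := by
  have hcont := hf.continuous
  have hdcont : Continuous (fderiv ℝ f) := hf.continuous_fderiv one_ne_zero
  have hunif : UniformContinuous (fderiv ℝ f) :=
    (hsupp.fderiv ℝ).uniformContinuous_of_continuous hdcont
  set K := Metric.cthickening 1 (tsupport f) with hK
  have hKc : IsCompact K := hsupp.isCompact.cthickening
  have hKfin : volume K ≠ ⊤ := hKc.measure_lt_top.ne
  have hint : Integrable (fun x => |f x|) := (hcont.integrable_of_hasCompactSupport hsupp).abs
  have hintfin : ∫⁻ x, ENNReal.ofReal |f x| ≠ ⊤ := by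
    rw [← ofReal_integral_eq_lintegral_ofReal hint (ae_of_all _ fun x => abs_nonneg _)]
    exact ENNReal.ofReal_ne_top
  have main : ∀ ε : ℝ, 0 < ε → ENNReal.ofReal (n * ballVol n ^ (n : ℝ)⁻¹) *
      ∫⁻ t in Set.Ioi (0 : ℝ), volume {x | t < |f x|} ^ (1 - (n : ℝ)⁻¹) ≤
      (∫⁻ x, ENNReal.ofReal ‖fderiv ℝ f x‖) + ENNReal.ofReal ε * volume K := by
    intro ε hε
    obtain ⟨δ, hδ, hδε⟩ := Metric.uniformContinuous_iff.1 hunif ε hε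
    set h := min δ 1 with hh
    have hpos : 0 < h := lt_min hδ one_pos
    set w : EuclideanSpace ℝ (Fin n) → ℝ :=
      fun x => |f x| + h * (‖fderiv ℝ f x‖ + K.indicator (fun _ => ε) x) with hw
    have hind : ∀ x, 0 ≤ K.indicator (fun _ => ε) x := fun x =>
      Set.indicator_nonneg (fun _ _ => hε.le) _
    have hslope : ∀ x, 0 ≤ h * (‖fderiv ℝ f x‖ + K.indicator (fun _ => ε) x) := fun x => by
      have := hind x
      positivity
    have hw0 : ∀ x, 0 ≤ w x := fun x => by
      have := hslope x
      positivity
    have hindm : Measurable (K.indicator (fun _ => ε)) :=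
      measurable_const.indicator hKc.measurableSet
    have hwm : Measurable w := hcont.abs.measurable.add
      ((hdcont.norm.measurable.add hindm).const_mul h)
    have hincl : ∀ t : ℝ, 0 < t → ∀ x ∈ {x | t < |f x|},
        ∀ y ∈ Metric.ball (0 : EuclideanSpace ℝ (Fin n)) h, x + y ∈ {x | t < w x} := by
      intro t ht x hx y hy
      change t < |f x| at hx
      rw [mem_ball_zero_iff] at hy
      have hxs : x ∈ tsupport f := subset_tsupport f (by
        intro h0
        rw [h0, abs_zero] at hx
        exact absurd hx (not_lt.2 ht.le))
      have hz : x + y ∈ K := Metric.mem_cthickening_of_dist_le _ x _ _ hxs (by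
        rw [dist_eq_norm, add_sub_cancel_left]
        exact hy.le.trans (min_le_right _ _))
      have hmv := (convex_ball (x + y) h).norm_image_sub_le_of_norm_fderiv_le (𝕜 := ℝ) (f := f)
        (C := ‖fderiv ℝ f (x + y)‖ + ε) (x := x + y) (y := x)
        (fun z _ => hf.differentiable one_ne_zero z) (fun z hz => by
          have h1 := (hδε (lt_of_lt_of_le (Metric.mem_ball.1 hz) (min_le_left _ _))).le
          rw [dist_eq_norm] at h1
          have h2 := norm_le_norm_add_norm_sub' (fderiv ℝ f z) (fderiv ℝ f (x + y))
          linarith)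
        (Metric.mem_ball_self hpos) (by
          rw [Metric.mem_ball, dist_eq_norm, sub_add_cancel_left, norm_neg]; exact hy)
      rw [sub_add_cancel_left, norm_neg, Real.norm_eq_abs] at hmv
      change t < |f (x + y)| + h * (‖fderiv ℝ f (x + y)‖ + K.indicator (fun _ => ε) (x + y))
      rw [Set.indicator_of_mem hz]
      have h1 : |f x| ≤ |f (x + y)| + |f x - f (x + y)| := by
        have := abs_sub_abs_le_abs_sub (f x) (f (x + y))
        linarith
      have h2 : (‖fderiv ℝ f (x + y)‖ + ε) * ‖y‖ ≤ h * (‖fderiv ℝ f (x + y)‖ + ε) := by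
        rw [mul_comm]
        gcongr
      linarith
    have hAfin : ∀ t : ℝ, 0 < t → volume {x | t < |f x|} ≠ ⊤ := fun t ht => by
      refine ne_top_of_le_ne_top hsupp.isCompact.measure_lt_top.ne (measure_mono fun x hx => ?_)
      refine subset_tsupport f fun h0 => ?_
      change t < |f x| at hx
      rw [h0, abs_zero] at hx
      exact absurd hx (not_lt.2 ht.le)
    have hAm : ∀ t : ℝ, MeasurableSet {x | t < |f x|} := fun t =>
      measurableSet_lt measurable_const hcont.abs.measurable
    have hmeas : Measurable fun t : ℝ => volume {x | t < |f x|} :=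
      Antitone.measurable fun s t hst => measure_mono fun x (hx : t < |f x|) => hst.trans_lt hx
    have hlayer := lintegral_mono_ae (μ := volume.restrict (Set.Ioi (0 : ℝ)))
      ((ae_restrict_iff' measurableSet_Ioi).2 (ae_of_all _ fun t (ht : 0 < t) =>
        EuclideanSpace.volume_add_perimeter_le hn (hAm t) (measurableSet_lt measurable_const hwm)
          (hAfin t ht) hpos (hincl t ht)))
    rw [lintegral_add_left hmeas, lintegral_const_mul' _ _ ENNReal.ofReal_ne_top,
      lintegral_const_mul' _ _ ENNReal.ofReal_ne_top,
      ← lintegral_eq_lintegral_meas_lt volume (ae_of_all _ fun x => abs_nonneg (f x))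
        hcont.abs.measurable.aemeasurable,
      ← lintegral_eq_lintegral_meas_lt volume (ae_of_all _ hw0) hwm.aemeasurable] at hlayer
    have hwint : ∫⁻ x, ENNReal.ofReal (w x) = (∫⁻ x, ENNReal.ofReal |f x|) +
        ENNReal.ofReal h * ((∫⁻ x, ENNReal.ofReal ‖fderiv ℝ f x‖) +
          ENNReal.ofReal ε * volume K) := by
      have : ∀ x, ENNReal.ofReal (w x) = ENNReal.ofReal |f x| + ENNReal.ofReal h *
          (ENNReal.ofReal ‖fderiv ℝ f x‖ + K.indicator (fun _ => ENNReal.ofReal ε) x) := by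
        intro x
        rw [hw, ENNReal.ofReal_add (abs_nonneg _) (hslope x),
          ENNReal.ofReal_mul hpos.le, ENNReal.ofReal_add (norm_nonneg _) (hind x)]
        by_cases hx : x ∈ K <;> simp [hx]
      simp_rw [this]
      rw [lintegral_add_left hcont.abs.measurable.ennreal_ofReal,
        lintegral_const_mul' _ _ ENNReal.ofReal_ne_top,
        lintegral_add_left hdcont.norm.measurable.ennreal_ofReal,
        lintegral_indicator_const hKc.measurableSet]
    rw [hwint] at hlayer
    exact (ENNReal.mul_le_mul_iff_right (by simpa using hpos) ENNReal.ofReal_ne_top).1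
      ((ENNReal.add_le_add_iff_left hintfin).1 hlayer)
  have hlim : Tendsto (fun ε : ℝ => (∫⁻ x, ENNReal.ofReal ‖fderiv ℝ f x‖) +
      ENNReal.ofReal ε * volume K) (𝓝[>] 0) (𝓝 ((∫⁻ x, ENNReal.ofReal ‖fderiv ℝ f x‖) +
      ENNReal.ofReal 0 * volume K)) := by
    refine Tendsto.const_add _ (ENNReal.Tendsto.mul_const ?_ (.inr hKfin))
    exact (ENNReal.continuous_ofReal.tendsto 0).mono_left nhdsWithin_le_nhds
  rw [ENNReal.ofReal_zero, zero_mul, add_zero] at hlim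
  exact ge_of_tendsto hlim (eventually_nhdsWithin_of_forall fun ε hε => main ε hε)

/-- `‖u‖_{n/(n-1)} ≤ ∫ |{u > t}|^{(n-1)/n} dt`, for general Hölder conjugate exponents. -/
theorem lintegral_rpow_le_lintegral_superlevel_rpow {α : Type*} [MeasurableSpace α]
    (μ : Measure α) [SFinite μ] {p q : ℝ} (hpq : p.HolderConjugate q) {u : α → ℝ}
    (hu : Measurable u) (hu0 : ∀ x, 0 ≤ u x) (h0 : ∫⁻ x, ENNReal.ofReal (u x) ^ p ∂μ ≠ 0)
    (hfin : ∫⁻ x, ENNReal.ofReal (u x) ^ p ∂μ ≠ ⊤) :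
    (∫⁻ x, ENNReal.ofReal (u x) ^ p ∂μ) ^ (1 / p) ≤
      ∫⁻ t in Set.Ioi (0 : ℝ), μ {x | t < u x} ^ (1 / p) := by
  set M := ∫⁻ x, ENNReal.ofReal (u x) ^ p ∂μ with hM
  have hp := hpq.sub_one_pos
  have hum : Measurable fun x => ENNReal.ofReal (u x) := hu.ennreal_ofReal
  have hgm : Measurable fun x => ENNReal.ofReal (u x) ^ (p - 1) := hum.pow_const _
  have hlevel : ∀ t : ℝ, MeasurableSet {x | t < u x} := fun t =>
    measurableSet_lt measurable_const hu
  have h1 : M ≤ (∫⁻ t in Set.Ioi (0 : ℝ), μ {x | t < u x} ^ (1 / p)) * M ^ (1 / q) := by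
    calc M = ∫⁻ x, ENNReal.ofReal (u x)
            ∂(μ.withDensity fun x => ENNReal.ofReal (u x) ^ (p - 1)) := by
          rw [lintegral_withDensity_eq_lintegral_mul _ hgm hum]
          refine lintegral_congr fun x => ?_
          conv_lhs => rw [show p = (p - 1) + 1 by ring,
            ENNReal.rpow_add_of_nonneg _ _ hp.le zero_le_one, ENNReal.rpow_one]
          rfl
      _ = ∫⁻ t in Set.Ioi (0 : ℝ),
            ∫⁻ x, {x | t < u x}.indicator 1 x * ENNReal.ofReal (u x) ^ (p - 1) ∂μ := by
          rw [lintegral_eq_lintegral_meas_lt _ (ae_of_all _ hu0) hu.aemeasurable]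
          refine lintegral_congr fun t => ?_
          rw [withDensity_apply _ (hlevel t), ← lintegral_indicator (hlevel t)]
          refine lintegral_congr fun x => ?_
          by_cases hx : x ∈ {x | t < u x}
          · simp [Set.indicator_of_mem hx]
          · simp [Set.indicator_of_notMem hx]
      _ ≤ ∫⁻ t in Set.Ioi (0 : ℝ), μ {x | t < u x} ^ (1 / p) * M ^ (1 / q) := by
          refine lintegral_mono fun t => ?_
          refine (ENNReal.lintegral_mul_le_Lp_mul_Lq μ hpq
            (measurable_one.indicator (hlevel t)).aemeasurable hgm.aemeasurable).trans_eq ?_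
          congr 2
          · rw [← lintegral_indicator_one (hlevel t)]
            refine lintegral_congr fun x => ?_
            by_cases hx : x ∈ {x | t < u x}
            · simp [Set.indicator_of_mem hx]
            · simp [Set.indicator_of_notMem hx, hpq.pos]
          · refine lintegral_congr fun x => ?_
            rw [← ENNReal.rpow_mul, hpq.sub_one_mul_conj]
      _ = _ := by
          rw [lintegral_mul_const' _ _ (ENNReal.rpow_ne_top_of_nonneg (by
            have := hpq.symm.pos; positivity) hfin)]
  have h2 : M = M ^ (1 / p) * M ^ (1 / q) := by
    rw [← ENNReal.rpow_add _ _ h0 hfin, one_div, one_div, hpq.inv_add_inv_eq_one, ENNReal.rpow_one]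
  conv_lhs at h1 => rw [h2]
  exact (ENNReal.mul_le_mul_iff_left (by simp [h0, hfin]) (ENNReal.rpow_ne_top_of_nonneg (by
    have := hpq.symm.pos; positivity) hfin)).1 h1

/-- A consequence of Jensen's inequality: entropy is controlled by a higher moment. -/
theorem integral_mul_log_le_log_integral_rpow {α : Type*} [MeasurableSpace α] {μ : Measure α}
    {r : ℝ} (hr : 0 < r) {u : α → ℝ} (hu0 : ∀ x, 0 ≤ u x) (hint : Integrable u μ)
    (hone : ∫ x, u x ∂μ = 1) (hlog : Integrable (fun x => u x * Real.log (u x)) μ)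
    (hpow : Integrable (fun x => u x ^ (1 + r)) μ) (hc : 0 < ∫ x, u x ^ (1 + r) ∂μ) :
    r * ∫ x, u x * Real.log (u x) ∂μ ≤ Real.log (∫ x, u x ^ (1 + r) ∂μ) := by
  set c := ∫ x, u x ^ (1 + r) ∂μ with hcdef
  have hpt : ∀ x, r * (u x * Real.log (u x)) ≤ c⁻¹ * u x ^ (1 + r) + (Real.log c - 1) * u x := by
    intro x
    rcases (hu0 x).eq_or_lt with h | h
    · simp [← h, Real.zero_rpow (show 1 + r ≠ 0 by positivity)]
    · have h1 := Real.log_le_sub_one_of_pos (show 0 < u x ^ r / c by positivity)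
      rw [Real.log_div (by positivity) hc.ne', Real.log_rpow h] at h1
      rw [Real.rpow_add h, Real.rpow_one]
      have := mul_le_mul_of_nonneg_left h1 h.le
      have e : u x * (u x ^ r / c - 1) = c⁻¹ * (u x * u x ^ r) - u x := by field_simp
      linarith
  have := integral_mono (hlog.const_mul r)
    ((hpow.const_mul c⁻¹).add (hint.const_mul (Real.log c - 1))) hpt
  rw [integral_const_mul] at this
  refine this.trans_eq ?_
  simp only [Pi.add_apply]
  rw [integral_add (hpow.const_mul c⁻¹) (hint.const_mul _), integral_const_mul,
    integral_const_mul, hone, ← hcdef, inv_mul_cancel₀ hc.ne']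
  ring

/-- Sharp `L^1`-logarithmic Sobolev inequality in `ℝ^n` (Theorem 1.2 with `p = 1`). -/
theorem sharp_L1_log_sobolev_euclidean (n : ℕ) (hn : 2 ≤ n)
    (f : EuclideanSpace ℝ (Fin n) → ℝ) (hf : ContDiff ℝ (⊤ : ℕ∞) f)
    (hsupp : HasCompactSupport f)
    (hnorm : ∫ x : EuclideanSpace ℝ (Fin n), |f x| = 1) :
    ∫ x : EuclideanSpace ℝ (Fin n), |f x| * Real.log |f x| ≤
      (n : ℝ) * Real.log
        ((n : ℝ)⁻¹ * ballVol n ^ (-(1 : ℝ) / n) *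
          ∫ x : EuclideanSpace ℝ (Fin n), ‖fderiv ℝ f x‖) := by
  have hn2 : (2 : ℝ) ≤ n := by exact_mod_cast hn
  have hn1 : (0 : ℝ) < n - 1 := by linarith
  have hn0 : (0 : ℝ) < n := by linarith
  have hω := ballVol_pos n
  have hf1 : ContDiff ℝ 1 f := hf.of_le (by exact_mod_cast le_top)
  have hcont := hf1.continuous
  have hdcont : Continuous (fderiv ℝ f) := hf1.continuous_fderiv one_ne_zero
  set r : ℝ := 1 / (n - 1) with hr
  have hrpos : 0 < r := by positivity
  set p : ℝ := 1 + r with hp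
  have hppos : 0 < p := by positivity
  have hpinv : 1 / p = 1 - (n : ℝ)⁻¹ := by rw [hp, hr]; field_simp; ring
  have hpq : p.HolderConjugate n := by
    refine Real.holderConjugate_iff.2 ⟨by linarith, ?_⟩
    rw [← one_div, hpinv]; ring
  have hint : Integrable (fun x => |f x|) := (hcont.integrable_of_hasCompactSupport hsupp).abs
  have hcomp : ∀ g : ℝ → ℝ, Continuous g → g 0 = 0 → Integrable fun x => g |f x| :=
    fun g hg hg0 => (hg.comp hcont.abs).integrable_of_hasCompactSupport
      (hsupp.comp_left (g := fun s => g |s|) (by simpa using hg0))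
  have hlog := hcomp (fun s => s * Real.log s) Real.continuous_mul_log (by simp)
  have hpow := hcomp (fun s => s ^ p) (Real.continuous_rpow_const hppos.le)
    (Real.zero_rpow hppos.ne')
  have hdint : Integrable (fun x => ‖fderiv ℝ f x‖) :=
    (hdcont.integrable_of_hasCompactSupport (hsupp.fderiv ℝ)).norm
  set M := ∫ x, |f x| ^ p with hM
  set D := ∫ x, ‖fderiv ℝ f x‖ with hD
  have hMpos : 0 < M := by
    have hnn : ∀ x, 0 ≤ |f x| ^ p := fun x => Real.rpow_nonneg (abs_nonneg _) _
    refine lt_of_le_of_ne (integral_nonneg hnn) fun h0 => ?_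
    have := (integral_eq_zero_iff_of_nonneg hnn hpow).1 h0.symm
    have h1 : ∫ x, |f x| = 0 := by
      rw [integral_eq_zero_of_ae]
      filter_upwards [this] with x hx
      exact (Real.rpow_eq_zero (abs_nonneg _) hppos.ne').1 hx
    linarith
  have hMl : ∫⁻ x, ENNReal.ofReal |f x| ^ p = ENNReal.ofReal M := by
    rw [hM, ofReal_integral_eq_lintegral_ofReal hpow
      (ae_of_all _ fun x => Real.rpow_nonneg (abs_nonneg _) _)]
    exact lintegral_congr fun x => ENNReal.ofReal_rpow_of_nonneg (abs_nonneg _) hppos.le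
  have hDl : ∫⁻ x, ENNReal.ofReal ‖fderiv ℝ f x‖ = ENNReal.ofReal D :=
    (ofReal_integral_eq_lintegral_ofReal hdint (ae_of_all _ fun x => norm_nonneg _)).symm
  have hsob := lintegral_superlevel_rpow_le_lintegral_norm_fderiv hn hf1 hsupp
  have hlp := lintegral_rpow_le_lintegral_superlevel_rpow
    (volume : Measure (EuclideanSpace ℝ (Fin n))) hpq hcont.abs.measurable
    (fun x => abs_nonneg (f x)) (by rw [hMl]; simpa using hMpos)
    (by rw [hMl]; exact ENNReal.ofReal_ne_top)
  rw [hMl, ENNReal.ofReal_rpow_of_pos hMpos, hpinv] at hlp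
  have hsobolev : n * ballVol n ^ (n : ℝ)⁻¹ * M ^ (1 - (n : ℝ)⁻¹) ≤ D := by
    rw [← ENNReal.ofReal_le_ofReal_iff (integral_nonneg fun x => norm_nonneg _),
      ENNReal.ofReal_mul (by positivity), ← hDl]
    exact le_trans (by gcongr) hsob
  have hjensen := integral_mul_log_le_log_integral_rpow hrpos (fun x => abs_nonneg (f x)) hint
    hnorm hlog hpow hMpos
  have hlower : M ^ (1 - (n : ℝ)⁻¹) ≤ (n : ℝ)⁻¹ * ballVol n ^ (-(1 : ℝ) / n) * D := by
    calc M ^ (1 - (n : ℝ)⁻¹) = (n : ℝ)⁻¹ * ballVol n ^ (-(1 : ℝ) / n) *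
          (n * ballVol n ^ (n : ℝ)⁻¹ * M ^ (1 - (n : ℝ)⁻¹)) := by
          rw [neg_div, one_div, Real.rpow_neg hω.le]
          field_simp
      _ ≤ _ := by gcongr
  have hfinal := Real.log_le_log (by positivity) hlower
  rw [Real.log_rpow hMpos] at hfinal
  calc ∫ x, |f x| * Real.log |f x| = (n - 1) * (r * ∫ x, |f x| * Real.log |f x|) := by
        rw [hr]; field_simp
    _ ≤ (n - 1) * Real.log M := by gcongr
    _ = n * ((1 - (n : ℝ)⁻¹) * Real.log M) := by field_simp
    _ ≤ _ := by gcongr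
end

section
/- Let n ≥ 2 be an integer, let V : ℝ^n → ℝ be a C^2 function and C_V ∈ ℝ a constant such that V(x) − |∇V(x)|^2/2 + ΔV(x) − n ≤ C_V for almost every x ∈ ℝ^n, and suppose G_V = ∫_{ℝ^n} e^{-V(x)} dx < ∞. Let γ_V be the probability measure on ℝ^n with density G_V^{-1} e^{-V} with respect to Lebesgue measure. Then for every smooth compactly supported function h : ℝ^n → ℝ with ∫_{ℝ^n} h^2 dγ_V = 1 one has ∫_{ℝ^n} h^2 log h^2 dγ_V ≤ 2 ∫_{ℝ^n} |∇h|^2 dγ_V + log ( G_V e^{C_V} / (2π)^{n/2} ), where h^2 log h^2 is interpreted as 0 where h vanishes. -/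
open Real MeasureTheory Filter Topology

/-- The Laplacian of `V : ℝ^n → ℝ` at `x`: the trace of the second derivative,
i.e. the sum of the pure second partial derivatives. -/
noncomputable def lapl (n : ℕ) (V : EuclideanSpace ℝ (Fin n) → ℝ)
    (x : EuclideanSpace ℝ (Fin n)) : ℝ :=
  ∑ i : Fin n, iteratedFDeriv ℝ 2 V x ![EuclideanSpace.single i 1, EuclideanSpace.single i 1]

section

open ProbabilityTheory Set

section CumulativeDistribution

variable {p q : ℝ → ℝ}

lemma hasDerivAt_integral_Iic (hc : Continuous p) (hi : Integrable p) (x : ℝ) :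
    HasDerivAt (fun x => ∫ t in Iic x, p t) (p x) x := by
  have h : (fun x => ∫ t in Iic x, p t) =
      fun x => (∫ t in Iic 0, p t) + ∫ t in (0 : ℝ)..x, p t := by
    ext y
    rw [← intervalIntegral.integral_Iic_sub_Iic hi.integrableOn hi.integrableOn]
    ring
  rw [h]
  exact (intervalIntegral.integral_hasDerivAt_right (hc.intervalIntegrable _ _)
    hc.stronglyMeasurable.stronglyMeasurableAtFilter hc.continuousAt).const_add _

lemma strictMono_integral_Iic (hc : Continuous p) (hi : Integrable p) (hpos : ∀ x, 0 < p x) :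
    StrictMono fun x => ∫ t in Iic x, p t :=
  strictMono_of_deriv_pos fun x => by
    rw [(hasDerivAt_integral_Iic hc hi x).deriv]
    exact hpos x

lemma integral_Iic_mem_Ioo (hc : Continuous p) (hi : Integrable p) (hpos : ∀ x, 0 < p x)
    (hone : ∫ x, p x = 1) (x : ℝ) : ∫ t in Iic x, p t ∈ Ioo (0 : ℝ) 1 := by
  have hm := strictMono_integral_Iic hc hi hpos
  have hnonneg : ∀ y, 0 ≤ p y := fun y => (hpos y).le
  constructor
  · exact (setIntegral_nonneg measurableSet_Iic fun y _ => hnonneg y).trans_lt (hm (sub_one_lt x))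
  · exact (hm (lt_add_one x)).trans_le
      ((setIntegral_le_integral hi (ae_of_all _ hnonneg)).trans_eq hone)

lemma exists_integral_Iic_eq (hc : Continuous p) (hi : Integrable p) (hone : ∫ x, p x = 1)
    {c : ℝ} (h : c ∈ Ioo (0 : ℝ) 1) : ∃ x, ∫ t in Iic x, p t = c := by
  have hcont : Continuous fun x => ∫ t in Iic x, p t :=
    continuous_iff_continuousAt.2 fun x => (hasDerivAt_integral_Iic hc hi x).continuousAt
  have hbot : Tendsto (fun x => ∫ t in Iic x, p t) atBot (𝓝 0) :=
    tendsto_integral_Iic_zero tendsto_id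
  have htop : Tendsto (fun x => ∫ t in Iic x, p t) atTop (𝓝 1) := by
    rw [← hone]
    exact (aecover_Iic tendsto_id).integral_tendsto_of_countably_generated hi
  obtain ⟨a, ha⟩ := (hbot.eventually_lt_const h.1).exists
  obtain ⟨b, hb⟩ := (htop.eventually_const_lt h.2).exists
  exact mem_range_of_exists_le_of_exists_ge hcont ⟨a, ha.le⟩ ⟨b, hb.le⟩

/-- The monotone rearrangement between two positive continuous probability densities. -/
lemma exists_monotone_transport (hpc : Continuous p) (hpi : Integrable p) (hp : ∀ x, 0 < p x)
    (hp1 : ∫ x, p x = 1) (hqc : Continuous q) (hqi : Integrable q) (hq : ∀ x, 0 < q x)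
    (hq1 : ∫ x, q x = 1) :
    ∃ T : ℝ → ℝ, (∀ x, ∫ t in Iic (T x), q t = ∫ t in Iic x, p t) ∧
      ∀ x, HasDerivAt T (p x / q (T x)) x := by
  choose T hT using fun x => exists_integral_Iic_eq hqc hqi hq1
    (integral_Iic_mem_Ioo hpc hpi hp hp1 x)
  have hpm := strictMono_integral_Iic hpc hpi hp
  have hqm := strictMono_integral_Iic hqc hqi hq
  have hTm : Monotone T := fun x y hxy => hqm.le_iff_le.1 <| by
    simp only [hT]
    exact hpm.monotone hxy
  have hTs : Function.Surjective T := fun y => by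
    obtain ⟨x, hx⟩ := exists_integral_Iic_eq hpc hpi hp1 (integral_Iic_mem_Ioo hqc hqi hq hq1 y)
    exact ⟨x, hqm.injective ((hT x).trans hx)⟩
  have hTc : Continuous T := hTm.continuous_of_surjective hTs
  refine ⟨T, hT, fun x => ?_⟩
  have hs : HasStrictDerivAt (fun x => ∫ t in Iic x, q t) (q (T x)) (T x) :=
    hasStrictDerivAt_of_hasDerivAt_of_continuousAt
      (Eventually.of_forall fun y => hasDerivAt_integral_Iic hqc hqi y) hqc.continuousAt
  have hne := (hq (T x)).ne'
  have hg := (hs.to_localInverse hne).hasDerivAt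
  have hg' : HasDerivAt (hs.localInverse _ _ _ hne) (q (T x))⁻¹ (∫ t in Iic x, p t) := by
    rw [← hT x]
    exact hg
  have hcomp := hg'.comp x (hasDerivAt_integral_Iic hpc hpi x)
  rw [inv_mul_eq_div] at hcomp
  refine hcomp.congr_of_eventuallyEq ?_
  filter_upwards [hTc.continuousAt.eventually (hs.eventually_left_inverse hne)] with y hy
  simp only [Function.comp_apply]
  rw [← hT y]
  exact hy.symm

end CumulativeDistribution

section GaussianTail

lemma gaussianPDFReal_zero_one (x : ℝ) :
    gaussianPDFReal 0 1 x = (√(2 * π))⁻¹ * Real.exp (-x ^ 2 / 2) := by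
  simp [gaussianPDFReal]

lemma continuous_gaussianPDFReal_zero_one : Continuous (gaussianPDFReal 0 1) := by
  simp only [funext gaussianPDFReal_zero_one]
  fun_prop

lemma gaussianPDFReal_zero_one_neg (x : ℝ) :
    gaussianPDFReal 0 1 (-x) = gaussianPDFReal 0 1 x := by
  simp [gaussianPDFReal_zero_one]

lemma hasDerivAt_gaussianPDFReal_zero_one (x : ℝ) :
    HasDerivAt (gaussianPDFReal 0 1) (-x * gaussianPDFReal 0 1 x) x := by
  simp only [funext gaussianPDFReal_zero_one]
  have h : HasDerivAt (fun y : ℝ => -y ^ 2 / 2) (-x) x := by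
    have := ((hasDerivAt_pow 2 x).neg.div_const 2)
    convert! this using 1
    simp
    ring
  convert! (h.exp.const_mul (√(2 * π))⁻¹) using 1
  ring

lemma integral_Ioi_gaussianPDFReal_le {x K : ℝ} (hx : 0 ≤ x) (hK : 0 ≤ K) :
    ∫ t in Ioi (x + K), gaussianPDFReal 0 1 t ≤
      Real.exp (-K ^ 2 / 2) * ∫ t in Ioi x, gaussianPDFReal 0 1 t := by
  have hi := integrable_gaussianPDFReal 0 1
  have hshift : ∫ t in Ioi (x + K), gaussianPDFReal 0 1 t =
      ∫ t in Ioi x, gaussianPDFReal 0 1 (t + K) := by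
    have := (measurePreserving_add_right (volume : Measure ℝ) K).setIntegral_preimage_emb
      (measurableEmbedding_addRight K) (gaussianPDFReal 0 1) (Ioi (x + K))
    rw [← this]
    simp
  rw [hshift, ← integral_const_mul]
  refine setIntegral_mono_on (hi.comp_add_right K).integrableOn (hi.const_mul _).integrableOn
    measurableSet_Ioi fun t ht => ?_
  have ht' : 0 ≤ t := hx.trans (mem_Ioi.1 ht).le
  rw [gaussianPDFReal_zero_one, gaussianPDFReal_zero_one, mul_left_comm, ← Real.exp_add]
  gcongr
  nlinarith [mul_nonneg ht' hK]

lemma integral_Iic_gaussianPDFReal_neg (x : ℝ) :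
    ∫ t in Iic (-x), gaussianPDFReal 0 1 t = ∫ t in Ioi x, gaussianPDFReal 0 1 t := by
  rw [← integral_comp_neg_Ioi]
  simp only [gaussianPDFReal_zero_one_neg]

lemma tendsto_gaussianPDFReal_zero_one_cocompact :
    Tendsto (gaussianPDFReal 0 1) (cocompact ℝ) (𝓝 0) := by
  have h : Tendsto (fun x : ℝ => -x ^ 2 / 2) (cocompact ℝ) atBot := by
    have h2 : Tendsto (fun x : ℝ => ‖x‖ ^ 2 / 2) (cocompact ℝ) atTop :=
      ((tendsto_pow_atTop two_ne_zero).comp tendsto_norm_cocompact_atTop).atTop_div_const two_pos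
    refine (tendsto_neg_atTop_atBot.comp h2).congr fun x => ?_
    simp [neg_div]
  simpa [funext gaussianPDFReal_zero_one] using
    (Real.tendsto_exp_atBot.comp h).const_mul (√(2 * π))⁻¹

end GaussianTail

section OneDimensional

variable {u u' : ℝ → ℝ} {ε M : ℝ}

lemma integrable_gaussianReal_of_bound {f : ℝ → ℝ} (hf : Continuous f) {C : ℝ}
    (hC : ∀ x, |f x| ≤ C) : Integrable f (gaussianReal 0 1) :=
  Integrable.of_bound hf.aestronglyMeasurable C (ae_of_all _ hC)

lemma integral_gaussianReal_zero_one (f : ℝ → ℝ) :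
    ∫ x, f x ∂gaussianReal 0 1 = ∫ x, f x * gaussianPDFReal 0 1 x := by
  rw [integral_gaussianReal_eq_integral_smul one_ne_zero]
  simp only [smul_eq_mul, mul_comm]

lemma integrable_mul_gaussianPDFReal {f : ℝ → ℝ} (hf : Continuous f) {C : ℝ}
    (hC : ∀ x, |f x| ≤ C) : Integrable fun x => f x * gaussianPDFReal 0 1 x :=
  (integrable_gaussianPDFReal 0 1).bdd_mul hf.aestronglyMeasurable (ae_of_all _ hC)

lemma abs_mul_log_le {a : ℝ} (hε : 0 < ε) (h1 : ε ≤ a) (h2 : a ≤ M) :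
    |a * Real.log a| ≤ M * max |Real.log ε| |Real.log M| := by
  have ha : 0 < a := hε.trans_le h1
  rw [abs_mul, abs_of_pos ha]
  exact mul_le_mul h2 (abs_le_max_abs_abs (Real.log_le_log hε h1) (Real.log_le_log ha h2))
    (abs_nonneg _) (ha.le.trans h2)

lemma abs_sq_div_le {a b : ℝ} (hε : 0 < ε) (h1 : ε ≤ a) (h2 : |b| ≤ M) :
    |b ^ 2 / (2 * a)| ≤ M ^ 2 / (2 * ε) := by
  have ha : 0 < a := hε.trans_le h1
  rw [abs_of_nonneg (by positivity), ← sq_abs b]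
  gcongr

/-- Along the transport to the standard Gaussian, a density relative to the Gaussian that is
bounded below moves points outwards by a bounded amount only. -/
lemma transport_bounds {T : ℝ → ℝ} {K : ℝ} (hK : 0 ≤ K) (hKε : Real.exp (-K ^ 2 / 2) ≤ ε)
    (hlo : ∀ x, ε ≤ u x) (hi : Integrable fun x => u x * gaussianPDFReal 0 1 x)
    (hone : ∫ x, u x * gaussianPDFReal 0 1 x = 1)
    (hT : ∀ x, ∫ t in Iic (T x), gaussianPDFReal 0 1 t =
      ∫ t in Iic x, u t * gaussianPDFReal 0 1 t) {R : ℝ} (hR : 0 ≤ R) :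
    T R ≤ R + K ∧ -(R + K) ≤ T (-R) := by
  have hφi := integrable_gaussianPDFReal 0 1
  have hφ1 := integral_gaussianPDFReal_eq_one 0 (one_ne_zero (α := NNReal))
  have hm := strictMono_integral_Iic continuous_gaussianPDFReal_zero_one hφi
    fun x => gaussianPDFReal_pos 0 1 x one_ne_zero
  have htail : ∫ t in Ioi (R + K), gaussianPDFReal 0 1 t ≤
      ε * ∫ t in Ioi R, gaussianPDFReal 0 1 t :=
    (integral_Ioi_gaussianPDFReal_le hR hK).trans <| mul_le_mul_of_nonneg_right hKε <|
      setIntegral_nonneg measurableSet_Ioi fun t _ => gaussianPDFReal_nonneg _ _ _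
  have hle : ∀ s : Set ℝ, ε * ∫ t in s, gaussianPDFReal 0 1 t ≤
      ∫ t in s, u t * gaussianPDFReal 0 1 t := fun s => by
    rw [← integral_const_mul]
    exact setIntegral_mono (hφi.const_mul _).integrableOn hi.integrableOn fun t =>
      mul_le_mul_of_nonneg_right (hlo t) (gaussianPDFReal_nonneg _ _ _)
  have hcompl : ∀ {f : ℝ → ℝ}, Integrable f → ∫ x, f x = 1 → ∀ x,
      ∫ t in Iic x, f t = 1 - ∫ t in Ioi x, f t := fun {f} hf hf1 x => by
    rw [← hf1, ← intervalIntegral.integral_Iic_add_Ioi hf.integrableOn hf.integrableOn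
      (b := x)]
    ring
  constructor
  · refine hm.le_iff_le.1 ?_
    simp only [hT]
    rw [hcompl hi hone, hcompl hφi hφ1]
    linarith [hle (Ioi R)]
  · refine hm.le_iff_le.1 ?_
    simp only [hT]
    rw [integral_Iic_gaussianPDFReal_neg]
    refine htail.trans ?_
    rw [← integral_Iic_gaussianPDFReal_neg]
    exact hle _

lemma gaussian_log_sobolev_real_of_integral_eq_one (hε : 0 < ε)
    (hu : ∀ x, HasDerivAt u (u' x) x) (hu'c : Continuous u') (hlo : ∀ x, ε ≤ u x)
    (hhi : ∀ x, u x ≤ M) (hu'b : ∀ x, |u' x| ≤ M)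
    (hone : ∫ x, u x * gaussianPDFReal 0 1 x = 1) :
    ∫ x, (u x * Real.log (u x) - u' x ^ 2 / (2 * u x)) * gaussianPDFReal 0 1 x ≤ 0 := by
  have hupos : ∀ x, 0 < u x := fun x => hε.trans_le (hlo x)
  have hφpos : ∀ x, 0 < gaussianPDFReal 0 1 x := fun x => gaussianPDFReal_pos 0 1 x one_ne_zero
  have hφc := continuous_gaussianPDFReal_zero_one
  have huc : Continuous u := continuous_iff_continuousAt.2 fun x => (hu x).continuousAt
  have hui : Integrable fun x => u x * gaussianPDFReal 0 1 x :=
    integrable_mul_gaussianPDFReal huc (C := M) fun x => by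
      rw [abs_of_pos (hupos x)]
      exact hhi x
  obtain ⟨T, hT, hT'⟩ := exists_monotone_transport (huc.mul hφc) hui
    (fun x => mul_pos (hupos x) (hφpos x)) hone hφc (integrable_gaussianPDFReal 0 1) hφpos
    (integral_gaussianPDFReal_eq_one 0 one_ne_zero)
  set g : ℝ → ℝ := fun x =>
    (u x * Real.log (u x) - u' x ^ 2 / (2 * u x)) * gaussianPDFReal 0 1 x with hg
  have hgi : Integrable g := by
    refine integrable_mul_gaussianPDFReal (C := M * max |Real.log ε| |Real.log M| +
      M ^ 2 / (2 * ε)) ?_ fun x => ?_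
    · exact (huc.mul (huc.log fun x => (hupos x).ne')).sub
        ((hu'c.pow 2).div (huc.const_mul 2) fun x => (mul_pos two_pos (hupos x)).ne')
    · exact (abs_sub _ _).trans
        (add_le_add (abs_mul_log_le hε (hlo x) (hhi x)) (abs_sq_div_le hε (hlo x) (hu'b x)))
  set B : ℝ → ℝ := fun x => (T x - x) * gaussianPDFReal 0 1 x * u x with hB
  have hB' : ∀ x, ∃ b, HasDerivAt B b x ∧ g x ≤ b := fun x => by
    refine ⟨_, (((hT' x).sub (hasDerivAt_id x)).mul
      (hasDerivAt_gaussianPDFReal_zero_one x)).mul (hu x), ?_⟩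
    simp only [id, hg, Pi.sub_apply, Pi.mul_apply]
    set D := u x * gaussianPDFReal 0 1 x / gaussianPDFReal 0 1 (T x) with hD
    have hux := hupos x
    have hlogD : Real.log (u x) - x ^ 2 / 2 + T x ^ 2 / 2 ≤ D - 1 := by
      refine le_trans (le_of_eq ?_)
        (Real.log_le_sub_one_of_pos (div_pos (mul_pos hux (hφpos x)) (hφpos (T x))))
      have hc : (√(2 * π))⁻¹ ≠ 0 := by positivity
      rw [hD, gaussianPDFReal_zero_one, gaussianPDFReal_zero_one,
        Real.log_div (by positivity) (by positivity), Real.log_mul hux.ne' (by positivity),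
        Real.log_mul hc (by positivity), Real.log_mul hc (by positivity), Real.log_exp,
        Real.log_exp]
      ring
    have hsq : 0 ≤ ((T x - x) * u x + u' x) ^ 2 / (2 * u x) := by positivity
    have hsq' : ((T x - x) * u x + u' x) ^ 2 / (2 * u x) =
        (T x - x) ^ 2 * u x / 2 + (T x - x) * u' x + u' x ^ 2 / (2 * u x) := by
      field_simp
      ring
    have hmul := mul_le_mul_of_nonneg_left hlogD hux.le
    have hle : u x * Real.log (u x) - u' x ^ 2 / (2 * u x) ≤
        (D - 1) * u x - x * (T x - x) * u x + (T x - x) * u' x := by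
      nlinarith [hmul, hsq, hsq']
    calc _ ≤ _ := mul_le_mul_of_nonneg_right hle (hφpos x).le
      _ = _ := by ring
  choose B' hBd hgB using hB'
  have hBc : Continuous B := continuous_iff_continuousAt.2 fun x => (hBd x).continuousAt
  set K := √(2 * |Real.log ε|) with hK
  have hK0 : 0 ≤ K := Real.sqrt_nonneg _
  have hKε : Real.exp (-K ^ 2 / 2) ≤ ε := by
    rw [hK, Real.sq_sqrt (by positivity), ← Real.le_log_iff_exp_le hε]
    linarith [neg_abs_le (Real.log ε)]
  have hM : 0 < M := (hupos 0).trans_le (hhi 0)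
  have hbd : ∀ R : ℝ, 0 ≤ R → ∫ x in (-R)..R, g x ≤ 2 * (K * M) * gaussianPDFReal 0 1 R := by
    intro R hR
    have hinteg : ∫ x in (-R)..R, g x ≤ B R - B (-R) :=
      intervalIntegral.integral_le_sub_of_hasDeriv_right_of_le (by linarith) hBc.continuousOn
        (fun x _ => (hBd x).hasDerivWithinAt) hgi.integrableOn fun x _ => hgB x
    obtain ⟨h1, h2⟩ := transport_bounds hK0 hKε hlo hui hone hT hR
    have hbound : ∀ x : ℝ, ∀ θ ≤ K,
        θ * gaussianPDFReal 0 1 x * u x ≤ K * M * gaussianPDFReal 0 1 x := fun x θ hθ => by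
      have := hφpos x
      have := hupos x
      have := hhi x
      calc θ * gaussianPDFReal 0 1 x * u x ≤ K * gaussianPDFReal 0 1 x * u x := by gcongr
        _ ≤ K * gaussianPDFReal 0 1 x * M := by gcongr
        _ = _ := by ring
    have hb1 := hbound R (T R - R) (by linarith)
    have hb2 := hbound (-R) (-(T (-R) - -R)) (by linarith)
    rw [gaussianPDFReal_zero_one_neg] at hb2
    simp only [hB] at hinteg
    rw [gaussianPDFReal_zero_one_neg] at hinteg
    linarith
  have hlim : Tendsto (fun R : ℝ => ∫ x in (-R)..R, g x) atTop (𝓝 (∫ x, g x)) :=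
    intervalIntegral_tendsto_integral hgi tendsto_neg_atTop_atBot tendsto_id
  have hlim0 : Tendsto (fun R : ℝ => 2 * (K * M) * gaussianPDFReal 0 1 R) atTop (𝓝 0) := by
    simpa using (tendsto_gaussianPDFReal_zero_one_cocompact.mono_left
      atTop_le_cocompact).const_mul (2 * (K * M))
  exact le_of_tendsto_of_tendsto hlim hlim0
    ((eventually_ge_atTop 0).mono fun R hR => hbd R hR)

lemma gaussian_log_sobolev_real (hε : 0 < ε)
    (hu : ∀ x, HasDerivAt u (u' x) x) (hu'c : Continuous u') (hlo : ∀ x, ε ≤ u x)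
    (hhi : ∀ x, u x ≤ M) (hu'b : ∀ x, |u' x| ≤ M) :
    ∫ x, u x * Real.log (u x) ∂gaussianReal 0 1 ≤
      (∫ x, u x ∂gaussianReal 0 1) * Real.log (∫ x, u x ∂gaussianReal 0 1) +
        ∫ x, u' x ^ 2 / (2 * u x) ∂gaussianReal 0 1 := by
  have hupos : ∀ x, 0 < u x := fun x => hε.trans_le (hlo x)
  have huc : Continuous u := continuous_iff_continuousAt.2 fun x => (hu x).continuousAt
  have hui : Integrable u (gaussianReal 0 1) :=
    integrable_gaussianReal_of_bound huc (C := M) fun x => by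
      rw [abs_of_pos (hupos x)]
      exact hhi x
  have hli : Integrable (fun x => u x * Real.log (u x)) (gaussianReal 0 1) :=
    integrable_gaussianReal_of_bound (huc.mul (huc.log fun x => (hupos x).ne')) fun x =>
      abs_mul_log_le hε (hlo x) (hhi x)
  have hdi : Integrable (fun x => u' x ^ 2 / (2 * u x)) (gaussianReal 0 1) :=
    integrable_gaussianReal_of_bound ((hu'c.pow 2).div (huc.const_mul 2)
      fun x => (mul_pos two_pos (hupos x)).ne') fun x => abs_sq_div_le hε (hlo x) (hu'b x)
  set m := ∫ x, u x ∂gaussianReal 0 1 with hm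
  have hmpos : 0 < m := by
    refine hε.trans_le ?_
    simpa using integral_mono (integrable_const ε) hui hlo
  have h := gaussian_log_sobolev_real_of_integral_eq_one (u := fun x => m⁻¹ * u x)
    (u' := fun x => m⁻¹ * u' x) (ε := m⁻¹ * ε) (M := m⁻¹ * M) (by positivity)
    (fun x => (hu x).const_mul _) (hu'c.const_mul _)
    (fun x => mul_le_mul_of_nonneg_left (hlo x) (by positivity))
    (fun x => mul_le_mul_of_nonneg_left (hhi x) (by positivity))
    (fun x => by
      rw [abs_mul, abs_of_pos (inv_pos.2 hmpos)]
      exact mul_le_mul_of_nonneg_left (hu'b x) (by positivity))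
    (by
      rw [← integral_gaussianReal_zero_one, integral_const_mul, ← hm]
      exact inv_mul_cancel₀ hmpos.ne')
  rw [← integral_gaussianReal_zero_one] at h
  have hrw : ∀ x, m⁻¹ * u x * Real.log (m⁻¹ * u x) - (m⁻¹ * u' x) ^ 2 / (2 * (m⁻¹ * u x)) =
      m⁻¹ * (u x * Real.log (u x) - Real.log m * u x - u' x ^ 2 / (2 * u x)) := fun x => by
    have := hupos x
    rw [Real.log_mul (by positivity) this.ne', Real.log_inv]
    field_simp
    ring
  simp only [hrw] at h
  have hsi : Integrable (fun x => u x * Real.log (u x) - Real.log m * u x) (gaussianReal 0 1) :=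
    hli.sub (hui.const_mul _)
  rw [integral_const_mul, integral_sub hsi hdi,
    integral_sub hli (hui.const_mul _), integral_const_mul, ← hm] at h
  have h' := nonpos_of_mul_nonpos_right h (inv_pos.2 hmpos)
  linarith

end OneDimensional

section Tensorization

variable {n : ℕ}

/-- The function `u` has continuous partial derivatives `D i`, takes values in `[ε, M]`, and its
partial derivatives are bounded by `M`. -/
structure HasBoundedPartials (u : (Fin n → ℝ) → ℝ) (D : Fin n → (Fin n → ℝ) → ℝ) (ε M : ℝ) :
    Prop where
  continuous : Continuous u
  continuous_partial : ∀ i, Continuous (D i)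
  hasDerivAt : ∀ i x t,
    HasDerivAt (fun s => u (Function.update x i s)) (D i (Function.update x i t)) t
  lower : ∀ x, ε ≤ u x
  upper : ∀ x, u x ≤ M
  abs_partial : ∀ i x, |D i x| ≤ M

lemma continuous_cons_left (y : Fin n → ℝ) :
    Continuous fun t : ℝ => (Fin.cons t y : Fin (n + 1) → ℝ) :=
  Continuous.finCons (A := fun _ => ℝ) (g := fun _ => y) continuous_id continuous_const

lemma continuous_cons_right (t : ℝ) :
    Continuous fun y : Fin n → ℝ => (Fin.cons t y : Fin (n + 1) → ℝ) :=
  Continuous.finCons (A := fun _ => ℝ) (f := fun _ => t) continuous_const continuous_id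

lemma continuous_integral_cons {f : (Fin (n + 1) → ℝ) → ℝ} (hf : Continuous f) {C : ℝ}
    (hC : ∀ x, |f x| ≤ C) :
    Continuous fun y : Fin n → ℝ => ∫ t, f (Fin.cons t y) ∂gaussianReal 0 1 :=
  continuous_of_dominated (bound := fun _ => C)
    (fun y => (hf.comp (continuous_cons_left y)).aestronglyMeasurable)
    (fun _ => ae_of_all _ fun _ => hC _) (integrable_const C)
    (ae_of_all _ fun t => hf.comp (continuous_cons_right t))

lemma abs_integral_cons_le {f : (Fin (n + 1) → ℝ) → ℝ} {C : ℝ} (hC : ∀ x, |f x| ≤ C)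
    (y : Fin n → ℝ) : |∫ t, f (Fin.cons t y) ∂gaussianReal 0 1| ≤ C := by
  simpa using norm_integral_le_of_norm_le_const (μ := gaussianReal 0 1)
    (f := fun t => f (Fin.cons t y)) (ae_of_all _ fun t => hC (Fin.cons t y))

lemma integrable_pi_gaussianReal_of_bound {f : (Fin n → ℝ) → ℝ} (hf : Continuous f) {C : ℝ}
    (hC : ∀ x, |f x| ≤ C) : Integrable f (Measure.pi fun _ => gaussianReal 0 1) :=
  Integrable.of_bound hf.aestronglyMeasurable C (ae_of_all _ hC)

lemma integral_pi_succ_gaussianReal {f : (Fin (n + 1) → ℝ) → ℝ} (hf : Continuous f) {C : ℝ}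
    (hC : ∀ x, |f x| ≤ C) :
    ∫ x, f x ∂(Measure.pi fun _ : Fin (n + 1) => gaussianReal 0 1) =
      ∫ y, ∫ t, f (Fin.cons t y) ∂gaussianReal 0 1
        ∂(Measure.pi fun _ : Fin n => gaussianReal 0 1) := by
  have h := ((measurePreserving_piFinSuccAbove (fun _ : Fin (n + 1) => gaussianReal 0 1) 0).symm)
  rw [← h.integral_comp', integral_prod_symm]
  · simp [MeasurableEquiv.piFinSuccAbove_symm_apply, Fin.insertNthEquiv]
  · exact (h.integrable_comp_emb (MeasurableEquiv.measurableEmbedding _)).2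
      (integrable_pi_gaussianReal_of_bound hf hC)

namespace HasBoundedPartials

variable {u : (Fin (n + 1) → ℝ) → ℝ} {D : Fin (n + 1) → (Fin (n + 1) → ℝ) → ℝ} {ε M : ℝ}

lemma abs_le {n : ℕ} {u : (Fin n → ℝ) → ℝ} {D : Fin n → (Fin n → ℝ) → ℝ}
    (h : HasBoundedPartials u D ε M) (hε : 0 < ε) (x : Fin n → ℝ) : |u x| ≤ M := by
  rw [abs_of_pos (hε.trans_le (h.lower x))]
  exact h.upper x

lemma continuous_mul_log {n : ℕ} {u : (Fin n → ℝ) → ℝ} {D : Fin n → (Fin n → ℝ) → ℝ}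
    (h : HasBoundedPartials u D ε M) (hε : 0 < ε) : Continuous fun x => u x * Real.log (u x) :=
  h.continuous.mul (h.continuous.log fun x => (hε.trans_le (h.lower x)).ne')

lemma continuous_sq_div {n : ℕ} {u : (Fin n → ℝ) → ℝ} {D : Fin n → (Fin n → ℝ) → ℝ}
    (h : HasBoundedPartials u D ε M) (hε : 0 < ε) (i : Fin n) :
    Continuous fun x => D i x ^ 2 / (2 * u x) :=
  ((h.continuous_partial i).pow 2).div (h.continuous.const_mul 2)
    fun x => (mul_pos two_pos (hε.trans_le (h.lower x))).ne'

lemma marginal (h : HasBoundedPartials u D ε M) (hε : 0 < ε) :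
    HasBoundedPartials (fun y : Fin n → ℝ => ∫ t, u (Fin.cons t y) ∂gaussianReal 0 1)
      (fun i y => ∫ t, D i.succ (Fin.cons t y) ∂gaussianReal 0 1) ε M where
  continuous := continuous_integral_cons h.continuous (h.abs_le hε)
  continuous_partial i := continuous_integral_cons (h.continuous_partial _) (h.abs_partial _)
  hasDerivAt i y s := by
    have hmeas : ∀ (f : (Fin (n + 1) → ℝ) → ℝ), Continuous f → ∀ y : Fin n → ℝ,
        AEStronglyMeasurable (fun t => f (Fin.cons t y)) (gaussianReal 0 1) := fun f hf y =>
      (hf.comp (continuous_cons_left y)).aestronglyMeasurable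
    refine (hasDerivAt_integral_of_dominated_loc_of_deriv_le (bound := fun _ => M)
      (F' := fun s t => D i.succ (Fin.cons t (Function.update y i s))) univ_mem
      (Eventually.of_forall fun s => hmeas u h.continuous _)
      (integrable_gaussianReal_of_bound (h.continuous.comp (continuous_cons_left _))
        fun t => h.abs_le hε _)
      (hmeas _ (h.continuous_partial _) _) (ae_of_all _ fun t s _ => h.abs_partial _ _)
      (integrable_const M) (ae_of_all _ fun t s _ => ?_)).2
    simp only [Fin.cons_update]
    exact h.hasDerivAt i.succ (Fin.cons t y) s
  lower y := by
    simpa using integral_mono (integrable_const ε)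
      (integrable_gaussianReal_of_bound (h.continuous.comp (continuous_cons_left y))
        fun t => h.abs_le hε _) fun t => h.lower (Fin.cons t y)
  upper y := (le_abs_self _).trans (abs_integral_cons_le (h.abs_le hε) y)
  abs_partial i y := abs_integral_cons_le (h.abs_partial _) y

/-- The Cauchy–Schwarz inequality for the Fisher information of a marginal. -/
lemma sq_integral_div_le (h : HasBoundedPartials u D ε M) (hε : 0 < ε) (i : Fin (n + 1))
    (y : Fin n → ℝ) :
    (∫ t, D i (Fin.cons t y) ∂gaussianReal 0 1) ^ 2 /
        (2 * ∫ t, u (Fin.cons t y) ∂gaussianReal 0 1) ≤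
      ∫ t, D i (Fin.cons t y) ^ 2 / (2 * u (Fin.cons t y)) ∂gaussianReal 0 1 := by
  have hui : Integrable (fun t => u (Fin.cons t y)) (gaussianReal 0 1) :=
    integrable_gaussianReal_of_bound (h.continuous.comp (continuous_cons_left y))
      fun t => h.abs_le hε _
  have hDi : Integrable (fun t => D i (Fin.cons t y)) (gaussianReal 0 1) :=
    integrable_gaussianReal_of_bound ((h.continuous_partial i).comp (continuous_cons_left y))
      fun t => h.abs_partial _ _
  have hqi : Integrable (fun t => D i (Fin.cons t y) ^ 2 / (2 * u (Fin.cons t y)))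
      (gaussianReal 0 1) :=
    integrable_gaussianReal_of_bound ((h.continuous_sq_div hε i).comp (continuous_cons_left y))
      fun t => abs_sq_div_le hε (h.lower _) (h.abs_partial _ _)
  set A := ∫ t, u (Fin.cons t y) ∂gaussianReal 0 1
  set d := ∫ t, D i (Fin.cons t y) ∂gaussianReal 0 1
  have hA : 0 < A := hε.trans_le ((h.marginal hε).lower y)
  have hle : ∫ t, (d / A * D i (Fin.cons t y) - (d / A) ^ 2 / 2 * u (Fin.cons t y))
      ∂gaussianReal 0 1 ≤
      ∫ t, D i (Fin.cons t y) ^ 2 / (2 * u (Fin.cons t y)) ∂gaussianReal 0 1 := by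
    refine integral_mono ((hDi.const_mul _).sub (hui.const_mul _)) hqi fun t => ?_
    have hu : 0 < u (Fin.cons t y) := hε.trans_le (h.lower _)
    have hsq : 0 ≤ (D i (Fin.cons t y) - d / A * u (Fin.cons t y)) ^ 2 /
      (2 * u (Fin.cons t y)) := by positivity
    have heq : (D i (Fin.cons t y) - d / A * u (Fin.cons t y)) ^ 2 / (2 * u (Fin.cons t y)) =
        D i (Fin.cons t y) ^ 2 / (2 * u (Fin.cons t y)) -
          (d / A * D i (Fin.cons t y) - (d / A) ^ 2 / 2 * u (Fin.cons t y)) := by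
      field_simp
      ring
    simp only
    linarith
  rw [integral_sub (hDi.const_mul _) (hui.const_mul _), integral_const_mul,
    integral_const_mul] at hle
  refine le_trans (le_of_eq ?_) hle
  change d ^ 2 / (2 * A) = d / A * d - (d / A) ^ 2 / 2 * A
  field_simp
  ring

end HasBoundedPartials

/-- The logarithmic Sobolev inequality for the standard Gaussian product measure. -/
theorem gaussian_log_sobolev_pi {u : (Fin n → ℝ) → ℝ} {D : Fin n → (Fin n → ℝ) → ℝ} {ε M : ℝ}
    (hε : 0 < ε) (h : HasBoundedPartials u D ε M) :
    ∫ x, u x * Real.log (u x) ∂(Measure.pi fun _ => gaussianReal 0 1) ≤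
      (∫ x, u x ∂(Measure.pi fun _ => gaussianReal 0 1)) *
        Real.log (∫ x, u x ∂(Measure.pi fun _ => gaussianReal 0 1)) +
      ∫ x, ∑ i, D i x ^ 2 / (2 * u x) ∂(Measure.pi fun _ => gaussianReal 0 1) := by
  induction n with
  | zero =>
    have hconst : ∀ f : (Fin 0 → ℝ) → ℝ,
        ∫ x, f x ∂(Measure.pi fun _ => gaussianReal 0 1) = f 0 := fun f => by
      have : f = fun _ => f 0 := funext fun x => by rw [Subsingleton.elim x 0]
      rw [this, integral_const]
      simp
    simp [hconst]
  | succ n ih =>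
    have hm := h.marginal hε
    have hlog : ∀ x, |u x * Real.log (u x)| ≤ M * max |Real.log ε| |Real.log M| := fun x =>
      abs_mul_log_le hε (h.lower x) (h.upper x)
    have hq : ∀ i x, |D i x ^ 2 / (2 * u x)| ≤ M ^ 2 / (2 * ε) := fun i x =>
      abs_sq_div_le hε (h.lower x) (h.abs_partial i x)
    have hqc := h.continuous_sq_div hε
    have hsum : ∫ x, ∑ i, D i x ^ 2 / (2 * u x) ∂(Measure.pi fun _ => gaussianReal 0 1) =
        ∑ i, ∫ y, ∫ t, D i (Fin.cons t y) ^ 2 / (2 * u (Fin.cons t y)) ∂gaussianReal 0 1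
          ∂(Measure.pi fun _ => gaussianReal 0 1) := by
      rw [integral_finsetSum _ fun i _ => integrable_pi_gaussianReal_of_bound (hqc i) (hq i)]
      exact Finset.sum_congr rfl fun i _ => integral_pi_succ_gaussianReal (hqc i) (hq i)
    have hinner : ∀ i, Integrable (fun y : Fin n → ℝ =>
        ∫ t, D i (Fin.cons t y) ^ 2 / (2 * u (Fin.cons t y)) ∂gaussianReal 0 1)
        (Measure.pi fun _ => gaussianReal 0 1) := fun i =>
      integrable_pi_gaussianReal_of_bound (continuous_integral_cons (hqc i) (hq i))
        (abs_integral_cons_le (hq i))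
    have hmlog : Integrable (fun y : Fin n → ℝ => (∫ t, u (Fin.cons t y) ∂gaussianReal 0 1) *
        Real.log (∫ t, u (Fin.cons t y) ∂gaussianReal 0 1))
        (Measure.pi fun _ => gaussianReal 0 1) :=
      integrable_pi_gaussianReal_of_bound (hm.continuous_mul_log hε) fun y =>
        abs_mul_log_le hε (hm.lower y) (hm.upper y)
    rw [integral_pi_succ_gaussianReal (h.continuous_mul_log hε) hlog,
      integral_pi_succ_gaussianReal h.continuous (h.abs_le hε), hsum, Fin.sum_univ_succ]
    have hfirst : ∫ y, ∫ t, u (Fin.cons t y) * Real.log (u (Fin.cons t y)) ∂gaussianReal 0 1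
        ∂(Measure.pi fun _ : Fin n => gaussianReal 0 1) ≤
        ∫ y, ((∫ t, u (Fin.cons t y) ∂gaussianReal 0 1) *
          Real.log (∫ t, u (Fin.cons t y) ∂gaussianReal 0 1) +
          ∫ t, D 0 (Fin.cons t y) ^ 2 / (2 * u (Fin.cons t y)) ∂gaussianReal 0 1)
        ∂(Measure.pi fun _ : Fin n => gaussianReal 0 1) := by
      refine integral_mono (integrable_pi_gaussianReal_of_bound
        (continuous_integral_cons (h.continuous_mul_log hε) hlog) (abs_integral_cons_le hlog))
        (hmlog.add (hinner 0)) fun y => ?_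
      refine gaussian_log_sobolev_real hε (fun t => ?_)
        ((h.continuous_partial 0).comp (continuous_cons_left y)) (fun t => h.lower _)
        (fun t => h.upper _) (fun t => h.abs_partial 0 _)
      simpa [Fin.update_cons_zero] using h.hasDerivAt 0 (Fin.cons t y) t
    rw [integral_add hmlog (hinner 0)] at hfirst
    have hrest : ∫ y, ∑ i : Fin n, (∫ t, D i.succ (Fin.cons t y) ∂gaussianReal 0 1) ^ 2 /
          (2 * ∫ t, u (Fin.cons t y) ∂gaussianReal 0 1)
          ∂(Measure.pi fun _ : Fin n => gaussianReal 0 1) ≤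
        ∑ i : Fin n, ∫ y, ∫ t, D i.succ (Fin.cons t y) ^ 2 / (2 * u (Fin.cons t y))
          ∂gaussianReal 0 1 ∂(Measure.pi fun _ : Fin n => gaussianReal 0 1) := by
      have hci : ∀ i, Integrable (fun y : Fin n → ℝ =>
          (∫ t, D (Fin.succ i) (Fin.cons t y) ∂gaussianReal 0 1) ^ 2 /
          (2 * ∫ t, u (Fin.cons t y) ∂gaussianReal 0 1))
          (Measure.pi fun _ : Fin n => gaussianReal 0 1) := fun i =>
        integrable_pi_gaussianReal_of_bound (hm.continuous_sq_div hε i) fun y =>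
          abs_sq_div_le hε (hm.lower y) (hm.abs_partial i y)
      rw [integral_finsetSum _ fun i _ => hci i]
      exact Finset.sum_le_sum fun i _ =>
        integral_mono (hci i) (hinner i.succ) fun y => h.sq_integral_div_le hε i.succ y
    have hih := ih hm
    linarith

end Tensorization

section Euclidean

variable {n : ℕ}

lemma pi_gaussianReal_eq_withDensity :
    (Measure.pi fun _ : Fin n => gaussianReal 0 1) =
      volume.withDensity fun x : Fin n → ℝ => ENNReal.ofReal (∏ i, gaussianPDFReal 0 1 (x i)) := by
  refine Measure.pi_eq fun s hs => ?_
  have hi : Integrable (fun x : Fin n → ℝ => ∏ i, gaussianPDFReal 0 1 (x i))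
      (Measure.pi fun i => volume.restrict (s i)) :=
    Integrable.fintype_prod fun i => (integrable_gaussianPDFReal 0 1).restrict
  rw [withDensity_apply _ (MeasurableSet.univ_pi hs), volume_pi, Measure.restrict_pi_pi,
    ← ofReal_integral_eq_lintegral_ofReal hi
      (ae_of_all _ fun x => Finset.prod_nonneg fun i _ => gaussianPDFReal_nonneg _ _ _),
    integral_fintype_prod_eq_prod (fun _ x => gaussianPDFReal 0 1 x),
    ENNReal.ofReal_prod_of_nonneg fun i _ => integral_nonneg fun x => gaussianPDFReal_nonneg _ _ _]
  exact Finset.prod_congr rfl fun i _ => (gaussianReal_apply_eq_integral 0 one_ne_zero _).symm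

lemma prod_gaussianPDFReal (x : Fin n → ℝ) :
    ∏ i, gaussianPDFReal 0 1 (x i) =
      ((2 * π) ^ ((n : ℝ) / 2))⁻¹ * Real.exp (-‖WithLp.toLp 2 x‖ ^ 2 / 2) := by
  simp only [gaussianPDFReal_zero_one, Finset.prod_mul_distrib, Finset.prod_const,
    Finset.card_univ, Fintype.card_fin, ← Real.exp_sum, EuclideanSpace.real_norm_sq_eq]
  congr 1
  · rw [inv_pow, Real.sqrt_eq_rpow, ← Real.rpow_natCast, ← Real.rpow_mul (by positivity)]
    congr 2
    ring
  · rw [← Finset.sum_div, Finset.sum_neg_distrib]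

lemma integral_pi_gaussianReal (F : EuclideanSpace ℝ (Fin n) → ℝ) :
    ∫ y, F (WithLp.toLp 2 y) ∂(Measure.pi fun _ : Fin n => gaussianReal 0 1) =
      ((2 * π) ^ ((n : ℝ) / 2))⁻¹ * ∫ x, F x * Real.exp (-‖x‖ ^ 2 / 2) := by
  have hm : Measurable fun x : Fin n → ℝ => ENNReal.ofReal (∏ i, gaussianPDFReal 0 1 (x i)) :=
    (Finset.measurable_fun_prod _ fun i _ =>
      (measurable_gaussianPDFReal 0 1).comp (measurable_pi_apply i)).ennreal_ofReal
  rw [pi_gaussianReal_eq_withDensity, integral_withDensity_eq_integral_toReal_smul hm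
    (ae_of_all _ fun _ => ENNReal.ofReal_lt_top), ← integral_const_mul,
    ← (PiLp.volume_preserving_toLp (Fin n)).integral_comp
      (MeasurableEquiv.toLp 2 (Fin n → ℝ)).measurableEmbedding]
  refine integral_congr_ae (ae_of_all _ fun x => ?_)
  simp only [smul_eq_mul]
  rw [ENNReal.toReal_ofReal (Finset.prod_nonneg fun i _ => gaussianPDFReal_nonneg _ _ _),
    prod_gaussianPDFReal]
  ring

lemma sq_norm_eq_sum_sq_apply_single (L : EuclideanSpace ℝ (Fin n) →L[ℝ] ℝ) :
    ‖L‖ ^ 2 = ∑ i, L (EuclideanSpace.single i 1) ^ 2 := by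
  obtain ⟨v, rfl⟩ := (InnerProductSpace.toDual ℝ (EuclideanSpace ℝ (Fin n))).surjective L
  simp [EuclideanSpace.real_norm_sq_eq, EuclideanSpace.inner_single_right]

lemma integral_gaussianReal_log_sobolev_le {g : EuclideanSpace ℝ (Fin n) → ℝ}
    (hg : ContDiff ℝ 1 g) (hs : HasCompactSupport g)
    (h1 : ∫ y, g (WithLp.toLp 2 y) ^ 2 ∂(Measure.pi fun _ : Fin n => gaussianReal 0 1) = 1)
    {ε : ℝ} (hε : 0 < ε) :
    ∫ y, g (WithLp.toLp 2 y) ^ 2 * Real.log (g (WithLp.toLp 2 y) ^ 2)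
        ∂(Measure.pi fun _ : Fin n => gaussianReal 0 1) + ε * Real.log ε ≤
      (1 + ε) * Real.log (1 + ε) +
        2 * ∫ y, ‖fderiv ℝ g (WithLp.toLp 2 y)‖ ^ 2
          ∂(Measure.pi fun _ : Fin n => gaussianReal 0 1) := by
  set μ := Measure.pi fun _ : Fin n => gaussianReal 0 1
  have hgc := hg.continuous
  have hg'c := hg.continuous_fderiv one_ne_zero
  have htc : Continuous fun y : Fin n → ℝ => (WithLp.toLp 2 y : EuclideanSpace ℝ (Fin n)) :=
    PiLp.continuous_toLp 2 _
  obtain ⟨A, hA⟩ := hs.exists_bound_of_continuous hgc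
  obtain ⟨B, hB⟩ := (hs.fderiv ℝ).exists_bound_of_continuous hg'c
  have hA0 : 0 ≤ A := (norm_nonneg _).trans (hA 0)
  have hB0 : 0 ≤ B := (norm_nonneg _).trans (hB 0)
  have hg2 : ∀ x, g x ^ 2 ≤ A ^ 2 := fun x => by
    rw [← sq_abs]; exact pow_le_pow_left₀ (abs_nonneg _) (hA x) 2
  have hD : ∀ x i, |fderiv ℝ g x (EuclideanSpace.single i 1)| ≤ B := fun x i => by
    simpa using (fderiv ℝ g x).le_of_opNorm_le (hB x) (EuclideanSpace.single i 1)
  have hu : HasBoundedPartials (fun y : Fin n → ℝ => g (WithLp.toLp 2 y) ^ 2 + ε)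
      (fun i y => 2 * g (WithLp.toLp 2 y) *
        fderiv ℝ g (WithLp.toLp 2 y) (EuclideanSpace.single i 1)) ε (A ^ 2 + ε + 2 * A * B) := by
    refine ⟨by fun_prop, fun i => by fun_prop, fun i x t => ?_, fun x => ?_, fun x => ?_,
      fun i x => ?_⟩
    · have hd := ((hg.differentiable one_ne_zero _).hasFDerivAt.comp_hasDerivAt t
        ((PiLp.hasFDerivAt_toLp (𝕜 := ℝ) 2 (Function.update x i t)).comp_hasDerivAt t
          (hasDerivAt_update x i t)))
      refine ((hd.pow 2).add_const ε).congr_deriv ?_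
      norm_num
    · nlinarith [sq_nonneg (g (WithLp.toLp 2 x))]
    · nlinarith [hg2 (WithLp.toLp 2 x)]
    · rw [abs_mul, abs_mul, abs_two]
      have := mul_le_mul (hA (WithLp.toLp 2 x)) (hD (WithLp.toLp 2 x) i) (abs_nonneg _) hA0
      rw [Real.norm_eq_abs] at this
      nlinarith
  have hlsi := gaussian_log_sobolev_pi hε hu
  have hi2 : Integrable (fun y : Fin n → ℝ => g (WithLp.toLp 2 y) ^ 2) μ :=
    integrable_pi_gaussianReal_of_bound (by fun_prop) fun y => by
      rw [abs_of_nonneg (sq_nonneg _)]; exact hg2 _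
  have hi' : Integrable (fun y : Fin n → ℝ => ‖fderiv ℝ g (WithLp.toLp 2 y)‖ ^ 2) μ :=
    integrable_pi_gaussianReal_of_bound (C := B ^ 2) (by fun_prop) fun y => by
      rw [abs_of_nonneg (sq_nonneg _)]
      exact pow_le_pow_left₀ (norm_nonneg _) (hB _) 2
  have hl : Continuous fun x => g x ^ 2 * Real.log (g x ^ 2) :=
    Real.continuous_mul_log.comp (hgc.pow 2)
  obtain ⟨K, hK⟩ := HasCompactSupport.exists_bound_of_continuous
    (hs.comp_left (g := fun z => z ^ 2 * Real.log (z ^ 2)) (by simp)) hl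
  have hil : Integrable (fun y : Fin n → ℝ =>
      g (WithLp.toLp 2 y) ^ 2 * Real.log (g (WithLp.toLp 2 y) ^ 2)) μ :=
    integrable_pi_gaussianReal_of_bound (hl.comp htc) fun y => hK _
  have hmean : ∫ y, (g (WithLp.toLp 2 y) ^ 2 + ε) ∂μ = 1 + ε := by
    rw [integral_add hi2 (integrable_const _), h1]
    simp
  rw [hmean] at hlsi
  have hleft : ∫ y, g (WithLp.toLp 2 y) ^ 2 * Real.log (g (WithLp.toLp 2 y) ^ 2) ∂μ +
      ε * Real.log ε ≤ ∫ y, (g (WithLp.toLp 2 y) ^ 2 + ε) *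
        Real.log (g (WithLp.toLp 2 y) ^ 2 + ε) ∂μ := by
    have : ∫ _, ε * Real.log ε ∂μ = ε * Real.log ε := by simp
    rw [← this, ← integral_add hil (integrable_const _)]
    refine integral_mono (hil.add (integrable_const _))
      (integrable_pi_gaussianReal_of_bound (hu.continuous_mul_log hε)
        fun y => abs_mul_log_le hε (hu.lower y) (hu.upper y)) fun y => ?_
    have ha := sq_nonneg (g (WithLp.toLp 2 y))
    simp only
    generalize g (WithLp.toLp 2 y) ^ 2 = a at ha
    rw [add_mul]
    refine add_le_add ?_ (mul_le_mul_of_nonneg_left (Real.log_le_log hε (by linarith)) hε.le)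
    rcases ha.eq_or_lt with rfl | ha
    · simp
    · exact mul_le_mul_of_nonneg_left (Real.log_le_log ha (by linarith)) ha.le
  have hright : ∫ y, ∑ i, (2 * g (WithLp.toLp 2 y) *
        fderiv ℝ g (WithLp.toLp 2 y) (EuclideanSpace.single i 1)) ^ 2 /
          (2 * (g (WithLp.toLp 2 y) ^ 2 + ε)) ∂μ ≤
      2 * ∫ y, ‖fderiv ℝ g (WithLp.toLp 2 y)‖ ^ 2 ∂μ := by
    rw [← integral_const_mul]
    refine integral_mono_of_nonneg (ae_of_all _ fun y => Finset.sum_nonneg fun i _ => by positivity)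
      (hi'.const_mul 2) (ae_of_all _ fun y => ?_)
    simp only [sq_norm_eq_sum_sq_apply_single, Finset.mul_sum]
    refine Finset.sum_le_sum fun i _ => ?_
    rw [div_le_iff₀ (by positivity)]
    nlinarith [mul_nonneg hε.le (sq_nonneg (fderiv ℝ g (WithLp.toLp 2 y)
      (EuclideanSpace.single i 1)))]
  linarith

/-- **Gaussian logarithmic Sobolev inequality** on Euclidean space, for compactly supported
functions. -/
theorem gaussian_log_sobolev_of_hasCompactSupport {g : EuclideanSpace ℝ (Fin n) → ℝ}
    (hg : ContDiff ℝ 1 g) (hs : HasCompactSupport g)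
    (h1 : ∫ x, g x ^ 2 * Real.exp (-‖x‖ ^ 2 / 2) = (2 * π) ^ ((n : ℝ) / 2)) :
    ∫ x, g x ^ 2 * Real.log (g x ^ 2) * Real.exp (-‖x‖ ^ 2 / 2) ≤
      2 * ∫ x, ‖fderiv ℝ g x‖ ^ 2 * Real.exp (-‖x‖ ^ 2 / 2) := by
  have hZ : (0 : ℝ) < (2 * π) ^ ((n : ℝ) / 2) := by positivity
  have hg1 := integral_pi_gaussianReal fun x => g x ^ 2
  rw [h1, inv_mul_cancel₀ hZ.ne'] at hg1
  have hle := fun ε (hε : (0 : ℝ) < ε) => integral_gaussianReal_log_sobolev_le hg hs hg1 hε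
  rw [integral_pi_gaussianReal fun x => g x ^ 2 * Real.log (g x ^ 2),
    integral_pi_gaussianReal fun x => ‖fderiv ℝ g x‖ ^ 2] at hle
  have hlim := le_of_tendsto_of_tendsto (b := 𝓝[>] (0 : ℝ))
    (((Real.continuous_mul_log.tendsto 0).const_add _).mono_left nhdsWithin_le_nhds)
    (((Real.continuous_mul_log.comp (continuous_const_add (1 : ℝ))).tendsto 0
      |>.add_const _).mono_left nhdsWithin_le_nhds)
    (eventually_nhdsWithin_of_forall hle)
  simp only [Function.comp_apply, add_zero, zero_mul, Real.log_one, mul_zero, zero_add] at hlim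
  rw [mul_left_comm] at hlim
  exact le_of_mul_le_mul_left hlim (inv_pos.2 hZ)

end Euclidean

section Weighted

variable {n : ℕ} {V h : EuclideanSpace ℝ (Fin n) → ℝ}

lemma hasFDerivAt_half_norm_sq (x : EuclideanSpace ℝ (Fin n)) :
    HasFDerivAt (fun y : EuclideanSpace ℝ (Fin n) => ‖y‖ ^ 2 / 2) (innerSL ℝ x) x := by
  have h := (hasStrictFDerivAt_norm_sq x).hasFDerivAt.mul_const (2⁻¹ : ℝ)
  have h2 : (2⁻¹ : ℝ) • 2 • innerSL ℝ x = innerSL ℝ x := by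
    ext y
    simp
  rw [h2] at h
  simpa only [div_eq_mul_inv] using h

/-- A continuous function vanishing wherever a compactly supported function and its derivative both
vanish is integrable. -/
lemma integrable_of_eq_zero_of_fderiv_eq_zero (hs : HasCompactSupport h)
    {F : EuclideanSpace ℝ (Fin n) → ℝ} (hF : Continuous F)
    (h0 : ∀ x, h x = 0 → fderiv ℝ h x = 0 → F x = 0) : Integrable F := by
  refine hF.integrable_of_hasCompactSupport (hs.mono' fun x hx => ?_)
  by_contra hxt
  exact hx (h0 x (image_eq_zero_of_notMem_tsupport hxt)
    (Function.notMem_support.1 fun hx' => hxt (support_fderiv_subset ℝ hx')))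

lemma integral_sq_fderiv_sub_mul_exp_neg (hV : ContDiff ℝ 2 V) (hh : ContDiff ℝ 1 h)
    (hs : HasCompactSupport h) (i : Fin n) :
    ∫ x, 2 * (fderiv ℝ h x (EuclideanSpace.single i 1) -
        h x * (fderiv ℝ V x (EuclideanSpace.single i 1) - x i) / 2) ^ 2 * Real.exp (-V x) =
      ∫ x, (2 * fderiv ℝ h x (EuclideanSpace.single i 1) ^ 2 + h x ^ 2 *
        (iteratedFDeriv ℝ 2 V x ![EuclideanSpace.single i 1, EuclideanSpace.single i 1] - 1 -
          fderiv ℝ V x (EuclideanSpace.single i 1) ^ 2 / 2 + x i ^ 2 / 2)) * Real.exp (-V x) := by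
  set e : EuclideanSpace ℝ (Fin n) := EuclideanSpace.single i 1 with he
  have hV' : ContDiff ℝ 1 (fderiv ℝ V) := hV.fderiv_right le_rfl
  have hVd : Differentiable ℝ V := hV.differentiable two_ne_zero
  have hhd : Differentiable ℝ h := hh.differentiable one_ne_zero
  have hhc : Continuous h := hh.continuous
  have hh'c : Continuous (fderiv ℝ h) := hh.continuous_fderiv one_ne_zero
  have hVc : Continuous V := hV.continuous
  have hV'c : Continuous (fderiv ℝ V) := hV'.continuous
  have hV''c : Continuous (fderiv ℝ (fderiv ℝ V)) := hV'.continuous_fderiv one_ne_zero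
  have hφ : ∀ x, HasFDerivAt (fun x => (fderiv ℝ V x e - x i) * Real.exp (-V x))
      ((fderiv ℝ V x e - x i) • (Real.exp (-V x) • -fderiv ℝ V x) + Real.exp (-V x) •
        ((fderiv ℝ (fderiv ℝ V) x).flip e - EuclideanSpace.proj i)) x := fun x =>
    (((hV'.differentiable one_ne_zero x).hasFDerivAt.clm_apply (hasFDerivAt_const e x)
      |>.congr_fderiv (by simp)).sub (EuclideanSpace.proj i).hasFDerivAt).mul
      (hVd x).hasFDerivAt.neg.exp
  have hφe : ∀ x, fderiv ℝ (fun x => (fderiv ℝ V x e - x i) * Real.exp (-V x)) x e =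
      (iteratedFDeriv ℝ 2 V x ![e, e] - 1 - (fderiv ℝ V x e - x i) * fderiv ℝ V x e) *
        Real.exp (-V x) := fun x => by
    rw [(hφ x).fderiv, iteratedFDeriv_two_apply]
    simp [he]
    ring
  have hsq : ∀ x, fderiv ℝ (fun x => h x ^ 2) x e = 2 * h x * fderiv ℝ h x e := fun x => by
    rw [((hhd x).hasFDerivAt.pow 2).fderiv]
    simp
  have hs2 : Continuous fun x => iteratedFDeriv ℝ 2 V x ![e, e] := by
    simp only [iteratedFDeriv_two_apply]
    fun_prop
  have hinteg : ∀ {F : EuclideanSpace ℝ (Fin n) → ℝ}, Continuous F →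
      (∀ x, h x = 0 → fderiv ℝ h x = 0 → F x = 0) → Integrable F :=
    integrable_of_eq_zero_of_fderiv_eq_zero hs
  have hi₁ : Integrable fun x =>
      2 * h x * fderiv ℝ h x e * ((fderiv ℝ V x e - x i) * Real.exp (-V x)) :=
    hinteg (by fun_prop) fun x hx _ => by simp [hx]
  have hi₂ : Integrable fun x => h x ^ 2 * ((iteratedFDeriv ℝ 2 V x ![e, e] - 1 -
      (fderiv ℝ V x e - x i) * fderiv ℝ V x e) * Real.exp (-V x)) :=
    hinteg (by fun_prop) fun x hx _ => by simp [hx]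
  have hparts := integral_mul_fderiv_eq_neg_fderiv_mul_of_integrable (μ := volume)
    (f := fun x => h x ^ 2) (g := fun x => (fderiv ℝ V x e - x i) * Real.exp (-V x)) (v := e)
    (by simpa only [hsq] using hi₁) (by simpa only [hφe] using hi₂)
    (hinteg (by fun_prop) fun x hx _ => by simp [hx])
    (fun x _ => (hhd x).pow 2) (fun x _ => (hφ x).differentiableAt)
  simp only [hsq, hφe] at hparts
  rw [← sub_eq_zero, sub_neg_eq_add, ← integral_add hi₂ hi₁] at hparts
  rw [eq_comm, ← sub_eq_zero, ← hparts, ← integral_sub]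
  · refine integral_congr_ae (ae_of_all _ fun x => ?_)
    simp only
    ring
  · exact hinteg (by fun_prop) fun x hx hx' => by simp [hx, hx']
  · exact hinteg (by fun_prop) fun x hx hx' => by simp [hx, hx']

lemma integral_norm_sq_fderiv_sub_mul_exp_neg (hV : ContDiff ℝ 2 V) (hh : ContDiff ℝ 1 h)
    (hs : HasCompactSupport h) :
    2 * ∫ x, ‖fderiv ℝ h x - (h x / 2) • (fderiv ℝ V x - innerSL ℝ x)‖ ^ 2 * Real.exp (-V x) =
      2 * (∫ x, ‖fderiv ℝ h x‖ ^ 2 * Real.exp (-V x)) + ∫ x, h x ^ 2 *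
        (lapl n V x - n - ‖fderiv ℝ V x‖ ^ 2 / 2 + ‖x‖ ^ 2 / 2) * Real.exp (-V x) := by
  have hhc : Continuous h := hh.continuous
  have hh'c : Continuous (fderiv ℝ h) := hh.continuous_fderiv one_ne_zero
  have hVc : Continuous V := hV.continuous
  have hV' : ContDiff ℝ 1 (fderiv ℝ V) := hV.fderiv_right le_rfl
  have hV'c : Continuous (fderiv ℝ V) := hV'.continuous
  have hV''c : Continuous (fderiv ℝ (fderiv ℝ V)) := hV'.continuous_fderiv one_ne_zero
  have hs2 : ∀ e : EuclideanSpace ℝ (Fin n),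
      Continuous fun x => iteratedFDeriv ℝ 2 V x ![e, e] := fun e => by
    simp only [iteratedFDeriv_two_apply]
    fun_prop
  have hlc : Continuous (lapl n V) := continuous_finsetSum _ fun i _ => hs2 _
  have hinteg : ∀ {F : EuclideanSpace ℝ (Fin n) → ℝ}, Continuous F →
      (∀ x, h x = 0 → fderiv ℝ h x = 0 → F x = 0) → Integrable F :=
    integrable_of_eq_zero_of_fderiv_eq_zero hs
  rw [← integral_const_mul, ← integral_const_mul, ← integral_add]
  · have hL : ∀ x, 2 * (‖fderiv ℝ h x - (h x / 2) • (fderiv ℝ V x - innerSL ℝ x)‖ ^ 2 *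
        Real.exp (-V x)) = ∑ i : Fin n, 2 * (fderiv ℝ h x (EuclideanSpace.single i 1) -
          h x * (fderiv ℝ V x (EuclideanSpace.single i 1) - x i) / 2) ^ 2 *
          Real.exp (-V x) := fun x => by
      rw [sq_norm_eq_sum_sq_apply_single, Finset.sum_mul, Finset.mul_sum]
      refine Finset.sum_congr rfl fun i _ => ?_
      simp [EuclideanSpace.inner_single_right]
      ring
    have hR : ∀ x, 2 * (‖fderiv ℝ h x‖ ^ 2 * Real.exp (-V x)) + h x ^ 2 *
        (lapl n V x - n - ‖fderiv ℝ V x‖ ^ 2 / 2 + ‖x‖ ^ 2 / 2) * Real.exp (-V x) =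
        ∑ i : Fin n, (2 * fderiv ℝ h x (EuclideanSpace.single i 1) ^ 2 + h x ^ 2 *
          (iteratedFDeriv ℝ 2 V x ![EuclideanSpace.single i 1, EuclideanSpace.single i 1] - 1 -
          fderiv ℝ V x (EuclideanSpace.single i 1) ^ 2 / 2 + x i ^ 2 / 2)) *
            Real.exp (-V x) := fun x => by
      rw [← Finset.sum_mul, Finset.sum_add_distrib, ← Finset.mul_sum, ← Finset.mul_sum,
        Finset.sum_add_distrib, Finset.sum_sub_distrib, Finset.sum_sub_distrib, ← Finset.sum_div,
        ← Finset.sum_div, ← sq_norm_eq_sum_sq_apply_single, ← sq_norm_eq_sum_sq_apply_single,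
        ← EuclideanSpace.real_norm_sq_eq, lapl]
      simp
      ring
    simp only [hL, hR]
    rw [integral_finsetSum, integral_finsetSum]
    · exact Finset.sum_congr rfl fun i _ => integral_sq_fderiv_sub_mul_exp_neg hV hh hs i
    · exact fun i _ => hinteg (by fun_prop) fun x hx hx' => by simp [hx, hx']
    · exact fun i _ => hinteg (by fun_prop) fun x hx hx' => by simp [hx, hx']
  · exact hinteg (by fun_prop) fun x _ hx' => by simp [hx']
  · exact hinteg (by fun_prop) fun x hx _ => by simp [hx]

/-- The Gaussian logarithmic Sobolev inequality transferred to the weight `exp (-V)`. -/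
theorem log_sobolev_mul_exp_neg (hV : ContDiff ℝ 2 V) (hh : ContDiff ℝ 1 h)
    (hs : HasCompactSupport h) {G : ℝ} (hG : 0 < G) (h1 : ∫ x, h x ^ 2 * Real.exp (-V x) = G) :
    (∫ x, h x ^ 2 * Real.log (h x ^ 2) * Real.exp (-V x)) +
        G * Real.log ((2 * π) ^ ((n : ℝ) / 2) / G) ≤
      2 * (∫ x, ‖fderiv ℝ h x‖ ^ 2 * Real.exp (-V x)) + ∫ x, h x ^ 2 *
        (V x - ‖fderiv ℝ V x‖ ^ 2 / 2 + lapl n V x - n) * Real.exp (-V x) := by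
  set Z : ℝ := (2 * π) ^ ((n : ℝ) / 2)
  have hZ : 0 < Z := by positivity
  have hr : 0 < Z / G := div_pos hZ hG
  have hhc : Continuous h := hh.continuous
  have hVc : Continuous V := hV.continuous
  have hV' : ContDiff ℝ 1 (fderiv ℝ V) := hV.fderiv_right le_rfl
  have hV'c : Continuous (fderiv ℝ V) := hV'.continuous
  have hV''c : Continuous (fderiv ℝ (fderiv ℝ V)) := hV'.continuous_fderiv one_ne_zero
  have hlc : Continuous (lapl n V) := continuous_finsetSum _ fun i _ => by
    simp only [iteratedFDeriv_two_apply]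
    fun_prop
  have hlogc : Continuous fun x => h x ^ 2 * Real.log (h x ^ 2) :=
    Real.continuous_mul_log.comp (hhc.pow 2)
  have hinteg : ∀ {F : EuclideanSpace ℝ (Fin n) → ℝ}, Continuous F →
      (∀ x, h x = 0 → fderiv ℝ h x = 0 → F x = 0) → Integrable F :=
    integrable_of_eq_zero_of_fderiv_eq_zero hs
  set E : EuclideanSpace ℝ (Fin n) → ℝ := fun x => √(Z / G) * Real.exp (-(V x - ‖x‖ ^ 2 / 2) / 2)
    with hE
  have hE2 : ∀ x, E x ^ 2 = Z / G * Real.exp (-(V x - ‖x‖ ^ 2 / 2)) := fun x => by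
    rw [hE, mul_pow, Real.sq_sqrt hr.le, ← Real.exp_nat_mul]
    congr 2
    push_cast
    ring
  have hEexp : ∀ x, E x ^ 2 * Real.exp (-‖x‖ ^ 2 / 2) = Z / G * Real.exp (-V x) := fun x => by
    rw [hE2, mul_assoc, ← Real.exp_add]
    congr 2
    ring
  have hEd : ContDiff ℝ 1 E := by
    have hV1 : ContDiff ℝ 1 V := hV.of_le one_le_two
    have hn : ContDiff ℝ 1 fun x : EuclideanSpace ℝ (Fin n) => ‖x‖ ^ 2 := contDiff_norm_sq ℝ
    fun_prop
  have hEderiv : ∀ x, HasFDerivAt E (-(E x / 2) • (fderiv ℝ V x - innerSL ℝ x)) x := fun x => by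
    refine ((((hV.differentiable two_ne_zero x).hasFDerivAt.sub
      (hasFDerivAt_half_norm_sq x)).neg.mul_const (2⁻¹ : ℝ)).exp.const_mul √(Z / G)).congr_fderiv ?_
    ext y
    simp [hE, div_eq_mul_inv]
    ring
  have hg'sq : ∀ x, ‖fderiv ℝ (fun x => h x * E x) x‖ ^ 2 * Real.exp (-‖x‖ ^ 2 / 2) =
      Z / G * (‖fderiv ℝ h x - (h x / 2) • (fderiv ℝ V x - innerSL ℝ x)‖ ^ 2 *
        Real.exp (-V x)) := fun x => by
    have : fderiv ℝ (fun x => h x * E x) x =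
        E x • (fderiv ℝ h x - (h x / 2) • (fderiv ℝ V x - innerSL ℝ x)) := by
      refine (((hh.differentiable one_ne_zero x).hasFDerivAt.mul (hEderiv x)).congr_fderiv
        ?_).fderiv
      ext y
      simp
      ring
    rw [this, norm_smul, mul_pow, Real.norm_eq_abs, sq_abs, mul_right_comm, hEexp]
    ring
  have hgsq : ∀ x, (h x * E x) ^ 2 * Real.exp (-‖x‖ ^ 2 / 2) =
      Z / G * (h x ^ 2 * Real.exp (-V x)) := fun x => by
    rw [mul_pow, mul_assoc, hEexp]
    ring
  have hglog : ∀ x, (h x * E x) ^ 2 * Real.log ((h x * E x) ^ 2) * Real.exp (-‖x‖ ^ 2 / 2) =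
      Z / G * (h x ^ 2 * Real.log (h x ^ 2) * Real.exp (-V x) +
        (Real.log (Z / G) * (h x ^ 2 * Real.exp (-V x)) -
          h x ^ 2 * (V x - ‖x‖ ^ 2 / 2) * Real.exp (-V x))) := fun x => by
    rw [mul_right_comm, hgsq]
    rcases eq_or_ne (h x) 0 with hx | hx
    · simp [hx]
    · rw [mul_pow, hE2, Real.log_mul (by positivity) (by positivity),
        Real.log_mul hr.ne' (Real.exp_ne_zero _), Real.log_exp]
      ring
  have hlsi := gaussian_log_sobolev_of_hasCompactSupport (hh.mul hEd) hs.mul_right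
    (by simp only [hgsq, integral_const_mul, h1]; field_simp; rfl)
  simp only [hglog, hg'sq, integral_const_mul] at hlsi
  rw [mul_left_comm] at hlsi
  replace hlsi := le_of_mul_le_mul_left hlsi hr
  rw [integral_norm_sq_fderiv_sub_mul_exp_neg hV hh hs, integral_add, integral_sub,
    integral_const_mul, h1] at hlsi
  · have hsplit : ∫ x, h x ^ 2 * (V x - ‖fderiv ℝ V x‖ ^ 2 / 2 + lapl n V x - n) *
        Real.exp (-V x) = (∫ x, h x ^ 2 * (V x - ‖x‖ ^ 2 / 2) * Real.exp (-V x)) +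
        ∫ x, h x ^ 2 * (lapl n V x - n - ‖fderiv ℝ V x‖ ^ 2 / 2 + ‖x‖ ^ 2 / 2) *
          Real.exp (-V x) := by
      rw [← integral_add]
      · exact integral_congr_ae (ae_of_all _ fun x => by ring)
      · exact hinteg (by fun_prop) fun x hx _ => by simp [hx]
      · exact hinteg (by fun_prop) fun x hx _ => by simp [hx]
    linarith
  · exact hinteg (by fun_prop) fun x hx _ => by simp [hx]
  · exact hinteg (by fun_prop) fun x hx _ => by simp [hx]
  · exact hinteg (by fun_prop) fun x hx _ => by simp [hx]
  · exact hinteg (by fun_prop) fun x hx _ => by simp [hx]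

end Weighted

end

/-- Gaussian logarithmic-Sobolev inequality in `ℝ^n` (Euclidean case of Theorem 1.3). -/
theorem gaussian_log_sobolev_euclidean (n : ℕ) (hn : 2 ≤ n)
    (V : EuclideanSpace ℝ (Fin n) → ℝ) (hV : ContDiff ℝ 2 V) (CV : ℝ)
    (hbound : ∀ᵐ x ∂(volume : Measure (EuclideanSpace ℝ (Fin n))),
      V x - ‖fderiv ℝ V x‖ ^ 2 / 2 + lapl n V x - n ≤ CV)
    (hexp : Integrable fun x : EuclideanSpace ℝ (Fin n) => Real.exp (-V x))
    (GV : ℝ) (hGV : GV = ∫ x : EuclideanSpace ℝ (Fin n), Real.exp (-V x))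
    (γ : Measure (EuclideanSpace ℝ (Fin n)))
    (hγ : γ = volume.withDensity fun x => ENNReal.ofReal (GV⁻¹ * Real.exp (-V x)))
    (h : EuclideanSpace ℝ (Fin n) → ℝ) (hh : ContDiff ℝ (⊤ : ℕ∞) h)
    (hhsupp : HasCompactSupport h) (hnorm : ∫ x, (h x) ^ 2 ∂γ = 1) :
    ∫ x, (h x) ^ 2 * Real.log ((h x) ^ 2) ∂γ ≤
      2 * ∫ x, ‖fderiv ℝ h x‖ ^ 2 ∂γ +
        Real.log (GV * Real.exp CV / (2 * Real.pi) ^ ((n : ℝ) / 2)) := by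
  have hG : 0 < GV := hGV ▸ integral_exp_pos hexp
  have hVc : Continuous V := hV.continuous
  have hγint : ∀ F : EuclideanSpace ℝ (Fin n) → ℝ,
      ∫ x, F x ∂γ = GV⁻¹ * ∫ x, F x * Real.exp (-V x) := fun F => by
    rw [hγ, integral_withDensity_eq_integral_toReal_smul (by fun_prop)
      (ae_of_all _ fun _ => ENNReal.ofReal_lt_top), ← integral_const_mul]
    refine integral_congr_ae (ae_of_all _ fun x => ?_)
    simp only [smul_eq_mul]
    rw [ENNReal.toReal_ofReal (by positivity)]
    ring
  rw [hγint] at hnorm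
  have h1 : ∫ x, h x ^ 2 * Real.exp (-V x) = GV := by
    rwa [inv_mul_eq_one₀ hG.ne', eq_comm] at hnorm
  have hh1 : ContDiff ℝ 1 h := hh.of_le (by exact_mod_cast le_top)
  have hlsi := log_sobolev_mul_exp_neg hV hh1 hhsupp hG h1
  have hcurv : ∫ x, h x ^ 2 * (V x - ‖fderiv ℝ V x‖ ^ 2 / 2 + lapl n V x - n) * Real.exp (-V x) ≤
      CV * GV := by
    have hV' : ContDiff ℝ 1 (fderiv ℝ V) := hV.fderiv_right le_rfl
    have hhc : Continuous h := hh1.continuous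
    have hV'c : Continuous (fderiv ℝ V) := hV'.continuous
    have hV''c : Continuous (fderiv ℝ (fderiv ℝ V)) := hV'.continuous_fderiv one_ne_zero
    have hlc : Continuous (lapl n V) := continuous_finsetSum _ fun i _ => by
      simp only [iteratedFDeriv_two_apply]
      fun_prop
    rw [← h1, ← integral_const_mul]
    refine integral_mono_ae
      (integrable_of_eq_zero_of_fderiv_eq_zero hhsupp (by fun_prop) fun x hx _ => by simp [hx])
      (integrable_of_eq_zero_of_fderiv_eq_zero hhsupp (by fun_prop) fun x hx _ => by simp [hx]) ?_
    filter_upwards [hbound] with x hx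
    nlinarith [mul_le_mul_of_nonneg_left hx
      (mul_nonneg (sq_nonneg (h x)) (Real.exp_pos (-V x)).le)]
  have hZ : (0 : ℝ) < (2 * Real.pi) ^ ((n : ℝ) / 2) := by positivity
  rw [Real.log_div hZ.ne' hG.ne'] at hlsi
  rw [hγint, hγint, Real.log_div (by positivity) hZ.ne',
    Real.log_mul hG.ne' (Real.exp_ne_zero _), Real.log_exp]
  refine le_of_mul_le_mul_left ?_ hG
  rw [mul_add, mul_left_comm GV 2, mul_inv_cancel_left₀ hG.ne', mul_inv_cancel_left₀ hG.ne']
  linarith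
end

section
/- Let n ≥ 2 be an integer, p > 1, and p' = p/(p-1). Let ν be a Borel measure on [0,∞) such that the function ρ ↦ ν([0,ρ])/ρ^n is nonincreasing on (0,∞) and bounded above by ω_n, and let θ = lim_{ρ→∞} ν([0,ρ])/ρ^n. Then lim_{λ→0^+} λ^{n/p'} ∫_{[0,∞)} e^{-λ ρ^{p'}} dν(ρ) = θ · Γ(n/p' + 1). -/
open Real MeasureTheory Filter Topology

/-- Layer-cake formula: the integral of `exp (-g)` in terms of the sublevel sets of `g`. -/
theorem integral_exp_neg_eq_integral_measureReal_le {α : Type*} [MeasurableSpace α]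
    (μ : Measure α) {g : α → ℝ} (hg : Measurable g) (hg0 : 0 ≤ᵐ[μ] g)
    (hfin : ∀ s, 0 < s → μ {x | g x ≤ s} ≠ ⊤) :
    ∫ x, Real.exp (-g x) ∂μ = ∫ s in Set.Ioi 0, Real.exp (-s) * μ.real {x | g x ≤ s} := by
  have hmeas : Measurable fun x => Real.exp (-g x) := by fun_prop
  have hanti : Antitone fun t : ℝ => μ {x | t ≤ Real.exp (-g x)} := fun a b hab =>
    measure_mono fun x hx => hab.trans hx
  have himage : (fun s : ℝ => Real.exp (-s)) '' Set.Ioi 0 = Set.Ioo 0 1 := by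
    ext t
    constructor
    · rintro ⟨s, hs, rfl⟩
      exact ⟨Real.exp_pos _, Real.exp_lt_one_iff.2 (neg_lt_zero.2 hs)⟩
    · rintro ⟨h0, h1⟩
      exact ⟨-Real.log t, neg_pos.2 (Real.log_neg h0 h1), by simp [Real.exp_log h0]⟩
  have hlevel : ∀ s : ℝ, {x | Real.exp (-s) ≤ Real.exp (-g x)} = {x | g x ≤ s} := by
    intro s
    ext x
    simp
  have hzero : ∀ t : ℝ, 1 < t → μ {x | t ≤ Real.exp (-g x)} = 0 := by
    intro t ht
    refine measure_mono_null (fun x hx => ?_) (ae_iff.1 hg0)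
    intro hx0
    have : Real.exp (-g x) ≤ 1 := Real.exp_le_one_iff.2 (neg_nonpos.2 hx0)
    exact absurd (ht.trans_le hx) this.not_gt
  have hnull : ∀ᵐ t : ℝ, t ∈ Set.Ioi (0 : ℝ) \ Set.Ioo 0 1 →
      μ {x | t ≤ Real.exp (-g x)} = 0 := by
    filter_upwards [Measure.ae_ne volume (1 : ℝ)] with t ht1 ht
    refine hzero t (lt_of_le_of_ne ?_ (Ne.symm ht1))
    by_contra! h
    exact ht.2 ⟨ht.1, h⟩
  have hfinite : ∀ t ∈ Set.Ioo (0 : ℝ) 1, μ {x | t ≤ Real.exp (-g x)} ≠ ⊤ := by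
    rw [← himage]
    rintro _ ⟨s, hs, rfl⟩
    simpa only [hlevel] using hfin s hs
  have hlt : ∀ᵐ t ∂volume.restrict (Set.Ioi (0 : ℝ)), μ {x | t ≤ Real.exp (-g x)} < ⊤ := by
    rw [ae_restrict_iff' measurableSet_Ioi]
    filter_upwards [hnull] with t ht h0
    by_cases h : t ∈ Set.Ioo (0 : ℝ) 1
    · exact (hfinite t h).lt_top
    · simp [ht ⟨h0, h⟩]
  calc ∫ x, Real.exp (-g x) ∂μ
      = (∫⁻ t in Set.Ioi (0 : ℝ), μ {x | t ≤ Real.exp (-g x)}).toReal := by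
        rw [integral_eq_lintegral_of_nonneg_ae (ae_of_all _ fun x => (Real.exp_pos _).le)
          hmeas.aestronglyMeasurable,
          lintegral_eq_lintegral_meas_le μ (ae_of_all _ fun x => (Real.exp_pos _).le)
            hmeas.aemeasurable]
    _ = ∫ t in Set.Ioi (0 : ℝ), (μ {x | t ≤ Real.exp (-g x)}).toReal :=
        (integral_toReal hanti.measurable.aemeasurable hlt).symm
    _ = ∫ t in Set.Ioo (0 : ℝ) 1, (μ {x | t ≤ Real.exp (-g x)}).toReal := by
        refine setIntegral_eq_of_subset_of_ae_sdiff_eq_zero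
          measurableSet_Ioi.nullMeasurableSet Set.Ioo_subset_Ioi_self ?_
        filter_upwards [hnull] with t ht h
        rw [ht h, ENNReal.toReal_zero]
    _ = ∫ s in Set.Ioi 0, Real.exp (-s) * μ.real {x | g x ≤ s} := by
        rw [← himage, integral_image_eq_integral_abs_deriv_smul (f' := fun s => -Real.exp (-s))
          measurableSet_Ioi]
        · simp [Measure.real]
        · intro s _
          simpa using ((hasDerivAt_neg s).exp).hasDerivWithinAt
        · intro a _ b _ hab
          simpa using hab

/-- If `ν (Icc 0 ρ) ≤ C ρ ^ n` and `ν (Icc 0 ρ) / ρ ^ n → θ` at infinity, then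
`lam ^ (n / q)` times the integral of `exp (-lam ρ ^ q)` tends to `θ Γ(n / q + 1)` as `lam → 0⁺`. -/
theorem tendsto_rpow_mul_integral_exp_neg_mul_rpow {ν : Measure ℝ} (hν : ν (Set.Iio 0) = 0)
    {n : ℕ} {q C θ : ℝ} (hq : 0 < q)
    (hbound : ∀ ρ : ℝ, 0 < ρ → ν (Set.Icc 0 ρ) ≤ ENNReal.ofReal (C * ρ ^ n))
    (hC : 0 ≤ C)
    (hθ : Tendsto (fun ρ : ℝ => ν.real (Set.Icc 0 ρ) / ρ ^ n) atTop (𝓝 θ)) :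
    Tendsto (fun lam : ℝ => lam ^ ((n : ℝ) / q) * ∫ ρ, Real.exp (-(lam * ρ ^ q)) ∂ν)
      (𝓝[>] 0) (𝓝 (θ * Real.Gamma ((n : ℝ) / q + 1))) := by
  have hν0 : ∀ᵐ ρ ∂ν, 0 ≤ ρ := by
    rw [ae_iff]
    simpa [Set.Iio] using hν
  have hsub : ∀ lam s : ℝ, 0 < lam → 0 < s →
      ν {ρ | lam * ρ ^ q ≤ s} = ν (Set.Icc 0 ((s / lam) ^ q⁻¹)) := by
    intro lam s hlam hs
    refine measure_congr ?_
    filter_upwards [hν0] with ρ hρ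
    refine propext ?_
    change lam * ρ ^ q ≤ s ↔ 0 ≤ ρ ∧ ρ ≤ (s / lam) ^ q⁻¹
    rw [Real.le_rpow_inv_iff_of_pos hρ (by positivity) hq, le_div_iff₀' hlam]
    simp [hρ]
  have hpow : ∀ lam s : ℝ, 0 < lam → 0 < s →
      lam ^ ((n : ℝ) / q) * ((s / lam) ^ q⁻¹) ^ n = s ^ ((n : ℝ) / q) := by
    intro lam s hlam hs
    rw [← Real.rpow_natCast, ← Real.rpow_mul (by positivity), inv_mul_eq_div,
      Real.div_rpow hs.le hlam.le, mul_div_cancel₀ _ (by positivity)]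
  have hformula : ∀ lam : ℝ, 0 < lam →
      lam ^ ((n : ℝ) / q) * ∫ ρ, Real.exp (-(lam * ρ ^ q)) ∂ν =
        ∫ s in Set.Ioi 0, ν.real (Set.Icc 0 ((s / lam) ^ q⁻¹)) / ((s / lam) ^ q⁻¹) ^ n *
          (Real.exp (-s) * s ^ ((n : ℝ) / q)) := by
    intro lam hlam
    rw [integral_exp_neg_eq_integral_measureReal_le ν (by fun_prop), ← integral_const_mul]
    · refine setIntegral_congr_fun measurableSet_Ioi fun s hs => ?_
      have hs : 0 < s := hs
      have hr : 0 < (s / lam) ^ q⁻¹ := by positivity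
      simp only [Measure.real, hsub lam s hlam hs]
      rw [← hpow lam s hlam hs]
      field_simp
    · filter_upwards [hν0] with ρ hρ
      simp only [Pi.zero_apply]
      positivity
    · intro s hs
      rw [hsub lam s hlam hs]
      exact ne_top_of_le_ne_top ENNReal.ofReal_ne_top (hbound _ (by positivity))
  have hratio : ∀ ρ : ℝ, 0 < ρ → ‖ν.real (Set.Icc 0 ρ) / ρ ^ n‖ ≤ C := by
    intro ρ hρ
    rw [Real.norm_of_nonneg (by positivity), div_le_iff₀ (by positivity)]
    exact ENNReal.toReal_le_of_le_ofReal (by positivity) (hbound ρ hρ)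
  have hGamma : IntegrableOn (fun s : ℝ => Real.exp (-s) * s ^ ((n : ℝ) / q)) (Set.Ioi 0) := by
    simpa using Real.GammaIntegral_convergent (s := (n : ℝ) / q + 1) (by positivity)
  have hmeas : Monotone fun ρ : ℝ => ν (Set.Icc 0 ρ) := fun a b hab =>
    measure_mono (Set.Icc_subset_Icc_right hab)
  have hlim : Tendsto (fun lam : ℝ => ∫ s in Set.Ioi 0,
      ν.real (Set.Icc 0 ((s / lam) ^ q⁻¹)) / ((s / lam) ^ q⁻¹) ^ n *
        (Real.exp (-s) * s ^ ((n : ℝ) / q))) (𝓝[>] 0)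
      (𝓝 (∫ s in Set.Ioi 0, θ * (Real.exp (-s) * s ^ ((n : ℝ) / q)))) := by
    refine tendsto_integral_filter_of_dominated_convergence
      (fun s => C * (Real.exp (-s) * s ^ ((n : ℝ) / q))) ?_ ?_ (hGamma.const_mul C) ?_
    · refine Eventually.of_forall fun lam => Measurable.aestronglyMeasurable ?_
      have : Measurable fun ρ : ℝ => ν.real (Set.Icc 0 ρ) := hmeas.measurable.ennreal_toReal
      have : Measurable fun s : ℝ => ν.real (Set.Icc 0 ((s / lam) ^ q⁻¹)) :=
        this.comp (by fun_prop)
      fun_prop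
    · filter_upwards [self_mem_nhdsWithin] with lam hlam
      refine (ae_restrict_iff' measurableSet_Ioi).2 (ae_of_all _ fun s hs => ?_)
      have hlam : 0 < lam := hlam
      have hs : 0 < s := hs
      rw [norm_mul, Real.norm_of_nonneg (by positivity : 0 ≤ Real.exp (-s) * s ^ ((n : ℝ) / q))]
      gcongr
      exact hratio _ (by positivity)
    · refine (ae_restrict_iff' measurableSet_Ioi).2 (ae_of_all _ fun s hs => ?_)
      refine Tendsto.mul_const _ (hθ.comp ((tendsto_rpow_atTop (inv_pos.2 hq)).comp ?_))
      exact (tendsto_inv_nhdsGT_zero.const_mul_atTop hs).congr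
        fun lam => (div_eq_mul_inv s lam).symm
  rw [integral_const_mul] at hlim
  rw [Real.Gamma_eq_integral (by positivity), add_sub_cancel_right]
  refine hlim.congr' ?_
  filter_upwards [self_mem_nhdsWithin] with lam hlam using (hformula lam hlam).symm

/-- Asymptotics of the Gaussian-bubble integral `L₁` as `λ → 0⁺`
(first formula of Proposition 2.4(ii)). -/
theorem gaussian_bubble_L1_asymptotics (n : ℕ) (hn : 2 ≤ n) (p : ℝ) (hp : 1 < p)
    (ν : Measure ℝ) (hνneg : ν (Set.Iio 0) = 0)
    (hmono : AntitoneOn (fun ρ : ℝ => (ν (Set.Icc 0 ρ)).toReal / ρ ^ n) (Set.Ioi 0))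
    (hbound : ∀ ρ : ℝ, 0 < ρ → ν (Set.Icc 0 ρ) ≤ ENNReal.ofReal (ballVol n * ρ ^ n))
    (θ : ℝ)
    (hθ : Tendsto (fun ρ : ℝ => (ν (Set.Icc 0 ρ)).toReal / ρ ^ n) atTop (nhds θ)) :
    Tendsto
      (fun lam : ℝ =>
        lam ^ ((n : ℝ) / (p / (p - 1))) * ∫ ρ, Real.exp (-(lam * ρ ^ (p / (p - 1)))) ∂ν)
      (nhdsWithin 0 (Set.Ioi 0))
      (nhds (θ * Real.Gamma ((n : ℝ) / (p / (p - 1)) + 1))) := by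
  have hC : 0 ≤ ballVol n :=
    div_nonneg (Real.rpow_nonneg Real.pi_pos.le _) (Real.Gamma_pos_of_pos (by positivity)).le
  exact tendsto_rpow_mul_integral_exp_neg_mul_rpow hνneg
    (div_pos (zero_lt_one.trans hp) (sub_pos.2 hp)) hbound hC hθ
end
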